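/- Let m be a bounded function on the torus 𝕋^d which is of class C^{d+1} on ℝ^d \ ℤ^d and satisfies the Mikhlin condition |∂^α_ξ m(ξ)| ≤ c |ξ|^{−|α|} for all ξ ∈ (−1/2,1/2)^d \ {0} and all multi-indices α ∈ ℕ^d with |α| = α_1 + ⋯ + α_d ≤ d+1, for some constant c > 0. Then the Fourier multiplier operator T_m extends to a bounded operator from ℓ^p(ℤ^d) to itself for all 1 < p < ∞. -/

import Mathlib

open MeasureTheory Real Complex

/-- The open unit cube `(0,1)^d` in `ℝ^d`. -/
noncomputable def unitCube (d : ℕ) : Set (Fin d → ℝ) :=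
  Set.univ.pi fun _ => Set.Ioo (0 : ℝ) 1

/-- Discrete Fourier transform on `ℤ^d`: `F(f)(ξ) = ∑_{n ∈ ℤ^d} f(n) e^{2πi n·ξ}`. -/
noncomputable def dft (d : ℕ) (f : (Fin d → ℤ) → ℂ) (ξ : Fin d → ℝ) : ℂ :=
  ∑' n : Fin d → ℤ, f n * Complex.exp (2 * Real.pi * Complex.I * ∑ i, (n i : ℂ) * (ξ i : ℂ))

/-- The Fourier multiplier operator `T_m`, given by `T_m f = F⁻¹(m · F(f))`. -/
noncomputable def Tmult (d : ℕ) (m : (Fin d → ℝ) → ℂ) (f : (Fin d → ℤ) → ℂ)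
    (n : Fin d → ℤ) : ℂ :=
  ∫ ξ in unitCube d, m ξ * dft d f ξ *
    Complex.exp (-(2 * Real.pi * Complex.I) * ∑ i, (ξ i : ℂ) * (n i : ℂ))

/-- The `ℓ^p(ℤ^d)` norm, as the `L^p` norm with respect to counting measure. -/
noncomputable def lpNorm (d : ℕ) (f : (Fin d → ℤ) → ℂ) (p : ℝ) : ENNReal :=
  eLpNorm f (ENNReal.ofReal p) (Measure.count : Measure (Fin d → ℤ))

/-- The Euclidean norm on `ℝ^d`. -/
noncomputable def euclNorm (d : ℕ) (ξ : Fin d → ℝ) : ℝ :=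
  Real.sqrt (∑ i, ξ i ^ 2)

/-- The complement `ℝ^d \ ℤ^d` of the integer lattice in `ℝ^d`. -/
def latticeComp (d : ℕ) : Set (Fin d → ℝ) :=
  {ξ | ¬ ∃ n : Fin d → ℤ, ξ = fun i => (n i : ℝ)}

open scoped ENNReal NNReal

section Averages

variable {ι : Type*} {Q : ι → Finset ι}

lemma mem_comm_of_partition (hself : ∀ n, n ∈ Q n) (hQ : ∀ n, ∀ x ∈ Q n, Q x = Q n) {n x : ι} :
    x ∈ Q n ↔ n ∈ Q x :=
  ⟨fun h => hQ n x h ▸ hself n, fun h => hQ x n h ▸ hself x⟩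

/-- Averaging over the blocks of a partition into finite sets preserves sums. -/
lemma tsum_average_eq (hself : ∀ n, n ∈ Q n) (hQ : ∀ n, ∀ x ∈ Q n, Q x = Q n) (F : ι → ℝ≥0∞) :
    ∑' n, ((Q n).card : ℝ≥0∞)⁻¹ * ∑ x ∈ Q n, F x = ∑' n, F n := by
  classical
  have hcard : ∀ n, ((Q n).card : ℝ≥0∞) ≠ 0 := fun n => by
    simpa using Finset.ne_empty_of_mem (hself n)
  calc ∑' n, ((Q n).card : ℝ≥0∞)⁻¹ * ∑ x ∈ Q n, F x
      = ∑' n, ∑' x, if x ∈ Q n then ((Q n).card : ℝ≥0∞)⁻¹ * F x else 0 := by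
        refine tsum_congr fun n => ?_
        rw [tsum_eq_sum (s := Q n) (fun x hx => by simp [hx]), Finset.mul_sum]
        exact Finset.sum_congr rfl fun x hx => by simp [hx]
    _ = ∑' x, ∑' n, if x ∈ Q n then ((Q n).card : ℝ≥0∞)⁻¹ * F x else 0 := ENNReal.tsum_comm
    _ = ∑' x, F x := by
        refine tsum_congr fun x => ?_
        rw [tsum_eq_sum (s := Q x) (fun n hn => by
          rw [if_neg fun h => hn ((mem_comm_of_partition hself hQ).1 h)])]
        rw [Finset.sum_congr rfl (g := fun _ => ((Q x).card : ℝ≥0∞)⁻¹ * F x) fun n hn => by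
          rw [if_pos ((mem_comm_of_partition hself hQ).1 hn), hQ x n hn]]
        rw [Finset.sum_const, nsmul_eq_mul, ← mul_assoc,
          ENNReal.mul_inv_cancel (hcard x) (ENNReal.natCast_ne_top _), one_mul]

lemma enorm_average_le (F : ι → ℂ) (n : ι) :
    ‖((Q n).card : ℂ)⁻¹ * ∑ x ∈ Q n, F x‖ₑ ≤ ((Q n).card : ℝ≥0∞)⁻¹ * ∑ x ∈ Q n, ‖F x‖ₑ := by
  rw [enorm_mul]
  gcongr
  · rcases Nat.eq_zero_or_pos (Q n).card with h | h
    · simp [h]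
    · rw [enorm_inv (by simpa using h.ne')]
      gcongr
      rw [← ofReal_norm]; simp
  · exact enorm_sum_le _ _

lemma summable_norm_of_tsum_enorm_ne_top {F : ι → ℂ} (h : ∑' n, ‖F n‖ₑ ≠ ∞) :
    Summable fun n => ‖F n‖ := by
  have := ENNReal.summable_toReal h
  simpa using this

lemma tsum_enorm_ne_top {F : ι → ℂ} (h : Summable fun n => ‖F n‖) : ∑' n, ‖F n‖ₑ ≠ ∞ := by
  have := h.tsum_ofReal_ne_top
  simpa [ofReal_norm] using this

lemma summable_norm_average (hself : ∀ n, n ∈ Q n) (hQ : ∀ n, ∀ x ∈ Q n, Q x = Q n) {F : ι → ℂ}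
    (hF : Summable fun n => ‖F n‖) :
    Summable fun n => ‖((Q n).card : ℂ)⁻¹ * ∑ x ∈ Q n, F x‖ := by
  refine summable_norm_of_tsum_enorm_ne_top (ne_top_of_le_ne_top (tsum_enorm_ne_top hF) ?_)
  rw [← tsum_average_eq hself hQ fun n => ‖F n‖ₑ]
  exact ENNReal.tsum_le_tsum fun n => enorm_average_le F n

lemma tsum_average_eq_complex (hself : ∀ n, n ∈ Q n) (hQ : ∀ n, ∀ x ∈ Q n, Q x = Q n) {F : ι → ℂ}
    (hF : Summable fun n => ‖F n‖) :
    ∑' n, ((Q n).card : ℂ)⁻¹ * ∑ x ∈ Q n, F x = ∑' n, F n := by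
  classical
  have hcard : ∀ n, ((Q n).card : ℂ) ≠ 0 := fun n => by
    simpa using Finset.ne_empty_of_mem (hself n)
  let G : ι → ι → ℂ := fun n x => if x ∈ Q n then ((Q n).card : ℂ)⁻¹ * F x else 0
  have hG : Summable (Function.uncurry G) := by
    apply Summable.of_norm
    apply summable_norm_of_tsum_enorm_ne_top
    rw [ENNReal.tsum_prod']
    refine ne_top_of_le_ne_top (tsum_enorm_ne_top hF) ?_
    rw [← tsum_average_eq hself hQ fun n => ‖F n‖ₑ]
    refine ENNReal.tsum_le_tsum fun n => ?_
    rw [tsum_eq_sum (s := Q n) (fun x hx => by simp [G, hx]), Finset.mul_sum]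
    refine Finset.sum_le_sum fun x hx => ?_
    simp only [Function.uncurry, G, if_pos hx, enorm_mul]
    gcongr
    rw [enorm_inv (hcard n)]
    gcongr
    rw [← ofReal_norm]; simp
  calc ∑' n, ((Q n).card : ℂ)⁻¹ * ∑ x ∈ Q n, F x
      = ∑' n, ∑' x, G n x := by
        refine tsum_congr fun n => ?_
        rw [tsum_eq_sum (s := Q n) (fun x hx => by simp [G, hx]), Finset.mul_sum]
        exact Finset.sum_congr rfl fun x hx => by simp [G, hx]
    _ = ∑' x, ∑' n, G n x := hG.tsum_comm.symm
    _ = ∑' x, F x := by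
        refine tsum_congr fun x => ?_
        rw [tsum_eq_sum (s := Q x) (fun n hn => by
          simp only [G]
          rw [if_neg fun h => hn ((mem_comm_of_partition hself hQ).1 h)])]
        rw [Finset.sum_congr rfl (g := fun _ => ((Q x).card : ℂ)⁻¹ * F x) fun n hn => by
          simp only [G]
          rw [if_pos ((mem_comm_of_partition hself hQ).1 hn), hQ x n hn]]
        rw [Finset.sum_const, nsmul_eq_mul, ← mul_assoc, mul_inv_cancel₀ (hcard x), one_mul]

end Averages

section DyadicCubes

variable {d : ℕ}

/-- The dyadic cube of side `2 ^ k` containing `n`. -/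
noncomputable def dyadicCube (k : ℕ) (n : Fin d → ℤ) : Finset (Fin d → ℤ) :=
  Fintype.piFinset fun i => Finset.Ico (n i / 2 ^ k * 2 ^ k) (n i / 2 ^ k * 2 ^ k + 2 ^ k)

/-- The lower corner of the dyadic cube of side `2 ^ k` containing `n`. -/
def dyadicCorner (k : ℕ) (n : Fin d → ℤ) : Fin d → ℤ := fun i => n i / 2 ^ k * 2 ^ k

lemma mem_dyadicCube {k : ℕ} {n x : Fin d → ℤ} :
    x ∈ dyadicCube k n ↔ ∀ i, x i / 2 ^ k = n i / 2 ^ k := by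
  simp only [dyadicCube, Fintype.mem_piFinset, Finset.mem_Ico]
  refine forall_congr' fun i => ?_
  have h : (0 : ℤ) < 2 ^ k := by positivity
  rw [Int.ediv_eq_iff_of_pos h]

lemma self_mem_dyadicCube (k : ℕ) (n : Fin d → ℤ) : n ∈ dyadicCube k n :=
  mem_dyadicCube.2 fun _ => rfl

lemma card_dyadicCube (k : ℕ) (n : Fin d → ℤ) : (dyadicCube k n).card = (2 ^ k) ^ d := by
  have : ((2 : ℤ) ^ k).toNat = 2 ^ k := by
    rw [show (2 : ℤ) ^ k = ((2 ^ k : ℕ) : ℤ) by simp, Int.toNat_natCast]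
  simp [dyadicCube, Fintype.card_piFinset, this]

lemma dyadicCube_eq_of_mem {k j : ℕ} (hkj : k ≤ j) {n x : Fin d → ℤ} (h : x ∈ dyadicCube k n) :
    dyadicCube j x = dyadicCube j n := by
  have : ∀ i, x i / 2 ^ j = n i / 2 ^ j := fun i => by
    obtain ⟨l, rfl⟩ := Nat.exists_eq_add_of_le hkj
    rw [pow_add, ← Int.ediv_ediv_of_nonneg (by positivity), mem_dyadicCube.1 h i,
      Int.ediv_ediv_of_nonneg (by positivity)]
  simp [dyadicCube, this]

lemma dyadicCorner_eq_of_mem {k : ℕ} {n x : Fin d → ℤ} (h : x ∈ dyadicCube k n) :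
    dyadicCorner k x = dyadicCorner k n := by
  funext i
  simp [dyadicCorner, mem_dyadicCube.1 h i]

lemma dyadicCube_zero (n : Fin d → ℤ) : dyadicCube 0 n = {n} := by
  ext x
  simp [mem_dyadicCube, funext_iff]

lemma norm_sub_dyadicCorner_lt (k : ℕ) (n : Fin d → ℤ) : ‖n - dyadicCorner k n‖ < 2 ^ k := by
  rw [pi_norm_lt_iff (by positivity)]
  intro i
  have h : (0 : ℤ) < 2 ^ k := by positivity
  have h1 := Int.emod_nonneg (n i) h.ne'
  have h2 := Int.emod_lt_of_pos (n i) h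
  have h3 : (n - dyadicCorner k n) i = n i % 2 ^ k := by
    simp only [Pi.sub_apply, dyadicCorner]
    have := Int.emod_add_mul_ediv (n i) (2 ^ k)
    linarith
  rw [h3, Int.norm_eq_abs, abs_of_nonneg (by exact_mod_cast h1)]
  exact_mod_cast h2

/-- Calderón–Zygmund selection of dyadic cubes for a summable function at height `t`. -/
lemma exists_dyadic_selection (hd : d ≠ 0) (F : (Fin d → ℤ) → ℝ≥0∞) (hF : ∑' n, F n ≠ ∞)
    {t : ℝ≥0∞} (ht : t ≠ 0) (ht' : t ≠ ∞) :
    ∃ κ : (Fin d → ℤ) → ℕ,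
      (∀ n, ∀ x ∈ dyadicCube (κ n) n, κ x = κ n) ∧
      (∀ n, ((dyadicCube (κ n) n).card : ℝ≥0∞)⁻¹ * ∑ x ∈ dyadicCube (κ n) n, F x ≤ 2 ^ d * t) ∧
      (∀ n, κ n ≠ 0 →
        t < ((dyadicCube (κ n) n).card : ℝ≥0∞)⁻¹ * ∑ x ∈ dyadicCube (κ n) n, F x) := by
  classical
  obtain ⟨N, hN⟩ : ∃ N : ℕ, ∀ k, N ≤ k → ∑' n, F n ≤ t * (2 ^ k) ^ d := by
    obtain ⟨N, hN⟩ := ENNReal.exists_nat_gt (ENNReal.div_ne_top hF ht)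
    refine ⟨N, fun k hk => ?_⟩
    rw [ENNReal.div_lt_iff (Or.inl ht) (Or.inl ht')] at hN
    refine hN.le.trans ?_
    rw [mul_comm]
    gcongr
    have h1 : N ≤ (2 ^ k) ^ d :=
      (hk.trans (Nat.lt_two_pow_self).le).trans (Nat.le_self_pow hd _)
    exact_mod_cast h1
  let P : (Fin d → ℤ) → ℕ → Prop := fun n k => t * (2 ^ k) ^ d < ∑ x ∈ dyadicCube k n, F x
  have hP : ∀ n k, N ≤ k → ¬ P n k := fun n k hk =>
    not_lt.2 ((ENNReal.sum_le_tsum _).trans (hN k hk))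
  have hspec := fun n => (Nat.findGreatest_eq_iff (P := P n) (k := N)
    (m := Nat.findGreatest (P n) N)).1 rfl
  have hnot : ∀ n k, Nat.findGreatest (P n) N < k → ¬ P n k := fun n k hk => by
    rcases le_total k N with h | h
    · exact (hspec n).2.2 hk h
    · exact hP n k h
  have hc : ∀ k (n : Fin d → ℤ), ((dyadicCube k n).card : ℝ≥0∞) = (2 ^ k) ^ d := fun k n => by
    rw [card_dyadicCube]; simp
  have h0 : ∀ k : ℕ, ((2 : ℝ≥0∞) ^ k) ^ d ≠ 0 := fun k => by positivity
  have h0' : ∀ k : ℕ, ((2 : ℝ≥0∞) ^ k) ^ d ≠ ∞ := fun k => by finiteness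
  refine ⟨fun n => Nat.findGreatest (P n) N, fun n x hx => ?_, fun n => ?_, fun n hn => ?_⟩
  · have key : ∀ k, Nat.findGreatest (P n) N ≤ k → (P x k ↔ P n k) := fun k hk => by
      simp only [P]
      rw [dyadicCube_eq_of_mem hk hx]
    rw [Nat.findGreatest_eq_iff]
    refine ⟨(hspec n).1, fun h => (key _ le_rfl).2 ((hspec n).2.1 h), fun k hk hk' => ?_⟩
    rw [key k hk.le]
    exact (hspec n).2.2 hk hk'
  · have h1 := hnot n _ (Nat.lt_succ_self _)
    simp only [P, not_lt] at h1
    set k := Nat.findGreatest (P n) N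
    rw [hc, mul_comm, ← div_eq_mul_inv, ENNReal.div_le_iff (h0 k) (h0' k)]
    calc ∑ x ∈ dyadicCube k n, F x ≤ ∑ x ∈ dyadicCube (k + 1) n, F x := by
          refine Finset.sum_le_sum_of_subset fun x hx => ?_
          rw [← dyadicCube_eq_of_mem k.le_succ hx]
          exact self_mem_dyadicCube _ _
      _ ≤ _ := h1
      _ = _ := by rw [pow_succ, mul_pow]; ring
  · have h1 := (hspec n).2.1 hn
    simp only [P] at h1
    rwa [hc, mul_comm, ← div_eq_mul_inv, ENNReal.lt_div_iff_mul_lt (Or.inl (h0 _)) (Or.inl (h0' _))]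

end DyadicCubes

section WeakType

variable {d : ℕ}

/-- Convolution on `ℤ^d` with kernel `K`. -/
noncomputable def latticeConv (K f : (Fin d → ℤ) → ℂ) (n : Fin d → ℤ) : ℂ :=
  ∑' k, f k * K (n - k)

lemma summable_mul_of_bounded {ι : Type*} {f g : ι → ℂ} {B : ℝ} (hf : Summable fun n => ‖f n‖)
    (hg : ∀ n, ‖g n‖ ≤ B) : Summable fun n => f n * g n := by
  refine Summable.of_norm_bounded (hf.mul_right B) fun n => ?_
  rw [norm_mul]
  exact mul_le_mul_of_nonneg_left (hg n) (norm_nonneg _)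

/-- The number of lattice points in a dyadically scaled ball. -/
lemma count_norm_sub_lt_le (j : ℕ) (c : Fin d → ℤ) :
    Measure.count {n : Fin d → ℤ | ‖n - c‖ < 4 * 2 ^ j} ≤ 8 ^ d * (2 ^ j) ^ d := by
  have hsub : {n : Fin d → ℤ | ‖n - c‖ < 4 * 2 ^ j} ⊆
      (Fintype.piFinset fun i => Finset.Ico (c i - 4 * 2 ^ j) (c i + 4 * 2 ^ j) :
        Finset (Fin d → ℤ)) := by
    intro n hn
    rw [Set.mem_ofPred_eq, pi_norm_lt_iff (by positivity)] at hn
    simp only [Fintype.coe_piFinset, Set.mem_pi, Finset.coe_Ico, Set.mem_Ico, Set.mem_univ,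
      forall_const]
    intro i
    have h := hn i
    rw [Pi.sub_apply, Int.norm_eq_abs, abs_lt] at h
    have h1 : -(4 * 2 ^ j) < n i - c i := by exact_mod_cast h.1
    have h2 : n i - c i < 4 * 2 ^ j := by exact_mod_cast h.2
    constructor <;> linarith
  refine (measure_mono hsub).trans ?_
  rw [Measure.count_apply_finset]
  have : ∀ i, (Finset.Ico (c i - 4 * 2 ^ j) (c i + 4 * 2 ^ j)).card = 8 * 2 ^ j := fun i => by
    rw [Int.card_Ico, show c i + 4 * 2 ^ j - (c i - 4 * 2 ^ j) = ((8 * 2 ^ j : ℕ) : ℤ) by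
      push_cast; ring, Int.toNat_natCast]
  simp [Fintype.card_piFinset, this, mul_pow]

lemma count_eq_tsum {ι : Type*} [MeasurableSpace ι] [DiscreteMeasurableSpace ι] (S : Set ι) :
    Measure.count S = ∑' n, S.indicator (1 : ι → ℝ≥0∞) n := by
  rw [← lintegral_count, lintegral_indicator_one .of_discrete]

lemma mul_count_le_tsum {ι : Type*} [MeasurableSpace ι] [DiscreteMeasurableSpace ι] {S : Set ι}
    {t : ℝ≥0∞} {w : ι → ℝ≥0∞} (h : ∀ n ∈ S, t ≤ w n) :
    t * Measure.count S ≤ ∑' n, w n := by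
  rw [count_eq_tsum, ← ENNReal.tsum_mul_left]
  refine ENNReal.tsum_le_tsum fun n => ?_
  by_cases hn : n ∈ S
  · simpa [hn] using h n hn
  · simp [hn]

/-- The enlargement of the selected dyadic cubes has controlled cardinality. -/
lemma count_enlargement_le {κ : (Fin d → ℤ) → ℕ}
    (hκ : ∀ n, ∀ x ∈ dyadicCube (κ n) n, κ x = κ n) (E : Set (Fin d → ℤ))
    (hE : ∀ n ∈ E, ∀ x ∈ dyadicCube (κ n) n, x ∈ E) :
    Measure.count {n | ∃ k ∈ E, ‖n - dyadicCorner (κ k) k‖ < 4 * 2 ^ κ k} ≤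
      8 ^ d * Measure.count E := by
  classical
  let w : (Fin d → ℤ) → ℝ≥0∞ := fun k => E.indicator (fun k => (((2 : ℝ≥0∞) ^ κ k) ^ d)⁻¹) k
  let S : (Fin d → ℤ) → Set (Fin d → ℤ) := fun k => {n | ‖n - dyadicCorner (κ k) k‖ < 4 * 2 ^ κ k}
  have h0 : ∀ k : ℕ, ((2 : ℝ≥0∞) ^ k) ^ d ≠ 0 := fun k => by positivity
  have h0' : ∀ k : ℕ, ((2 : ℝ≥0∞) ^ k) ^ d ≠ ∞ := fun k => by finiteness
  calc Measure.count {n | ∃ k ∈ E, ‖n - dyadicCorner (κ k) k‖ < 4 * 2 ^ κ k}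
      = 1 * Measure.count {n | ∃ k ∈ E, ‖n - dyadicCorner (κ k) k‖ < 4 * 2 ^ κ k} := by
        rw [one_mul]
    _ ≤ ∑' n, ∑' k, w k * (S k).indicator 1 n := by
        refine mul_count_le_tsum fun n ⟨k, hk, hn⟩ => ?_
        refine le_trans ?_ (ENNReal.sum_le_tsum (dyadicCube (κ k) k))
        rw [Finset.sum_congr rfl (g := fun _ => (((2 : ℝ≥0∞) ^ κ k) ^ d)⁻¹)]
        · rw [Finset.sum_const, card_dyadicCube, nsmul_eq_mul]
          push_cast
          rw [ENNReal.mul_inv_cancel (h0 _) (h0' _)]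
        · intro x hx
          have hxS : n ∈ S x := by
            simpa only [S, Set.mem_ofPred_eq, hκ k x hx, dyadicCorner_eq_of_mem hx] using hn
          simp [w, hE k hk x hx, hxS, hκ k x hx]
    _ = ∑' k, ∑' n, w k * (S k).indicator 1 n := ENNReal.tsum_comm
    _ = ∑' k, w k * Measure.count (S k) := by
        refine tsum_congr fun k => ?_
        rw [ENNReal.tsum_mul_left, count_eq_tsum]
    _ ≤ ∑' k, 8 ^ d * E.indicator 1 k := by
        refine ENNReal.tsum_le_tsum fun k => ?_
        by_cases hk : k ∈ E
        · simp only [w, Set.indicator_of_mem hk, Pi.one_apply, mul_one]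
          calc (((2 : ℝ≥0∞) ^ κ k) ^ d)⁻¹ * Measure.count (S k)
              ≤ (((2 : ℝ≥0∞) ^ κ k) ^ d)⁻¹ * (8 ^ d * (2 ^ κ k) ^ d) := by
                gcongr
                exact count_norm_sub_lt_le _ _
            _ = 8 ^ d := by
                rw [mul_comm, mul_assoc, ENNReal.mul_inv_cancel (h0 _) (h0' _), mul_one]
        · simp [w, hk]
    _ = 8 ^ d * Measure.count E := by rw [ENNReal.tsum_mul_left, count_eq_tsum]

/-- Calderón–Zygmund weak type `(1,1)` bound for convolution operators on `ℤ^d`. -/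
theorem latticeConv_weakType (hd : d ≠ 0) {K : (Fin d → ℤ) → ℂ} {B : ℝ} (hB : ∀ n, ‖K n‖ ≤ B)
    {A H : ℝ≥0∞}
    (hL2 : ∀ f : (Fin d → ℤ) → ℂ, Summable (fun n => ‖f n‖) →
      ∑' n, ‖latticeConv K f n‖ₑ ^ 2 ≤ A * ∑' n, ‖f n‖ₑ ^ 2)
    (hH : ∀ (j : ℕ) (y : Fin d → ℤ), ‖y‖ < 2 ^ j →
      ∑' n, {n : Fin d → ℤ | 4 * 2 ^ j ≤ ‖n‖}.indicator (fun n => ‖K (n - y) - K n‖ₑ) n ≤ H)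
    {f : (Fin d → ℤ) → ℂ} (hf : Summable fun n => ‖f n‖) {t : ℝ≥0∞} (ht : t ≠ 0) (ht' : t ≠ ∞) :
    t * Measure.count {n | 2 * t < ‖latticeConv K f n‖ₑ} ≤
      (8 ^ d + A * 2 ^ d + 2 * H) * ∑' n, ‖f n‖ₑ := by
  classical
  obtain ⟨κ, hκ, havg, hsel⟩ :=
    exists_dyadic_selection hd (fun n => ‖f n‖ₑ) (tsum_enorm_ne_top hf) ht ht'
  set Q : (Fin d → ℤ) → Finset (Fin d → ℤ) := fun n => dyadicCube (κ n) n with hQdef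
  have hself : ∀ n, n ∈ Q n := fun n => self_mem_dyadicCube _ _
  have hQ : ∀ n, ∀ x ∈ Q n, Q x = Q n := fun n x hx => by
    simp only [hQdef, hκ n x hx]
    exact dyadicCube_eq_of_mem le_rfl hx
  set c : (Fin d → ℤ) → (Fin d → ℤ) := fun n => dyadicCorner (κ n) n with hcdef
  have hc : ∀ n, ∀ x ∈ Q n, c x = c n := fun n x hx => by
    simp only [hcdef, hκ n x hx]
    exact dyadicCorner_eq_of_mem hx
  set a : (Fin d → ℤ) → ℝ≥0∞ := fun n => ((Q n).card : ℝ≥0∞)⁻¹ * ∑ x ∈ Q n, ‖f x‖ₑ with hadef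
  set g : (Fin d → ℤ) → ℂ := fun n => ((Q n).card : ℂ)⁻¹ * ∑ x ∈ Q n, f x with hgdef
  set b : (Fin d → ℤ) → ℂ := fun n => f n - g n with hbdef
  have hsum_a : ∑' n, a n = ∑' n, ‖f n‖ₑ := tsum_average_eq hself hQ fun n => ‖f n‖ₑ
  have hga : ∀ n, ‖g n‖ₑ ≤ a n := fun n => enorm_average_le f n
  have hg : Summable fun n => ‖g n‖ := summable_norm_average hself hQ hf
  have hg1 : ∑' n, ‖g n‖ₑ ≤ ∑' n, ‖f n‖ₑ := hsum_a ▸ ENNReal.tsum_le_tsum hga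
  have hb : Summable fun n => ‖b n‖ :=
    (hf.add hg).of_nonneg_of_le (fun n => norm_nonneg _) fun n => norm_sub_le _ _
  have hb1 : ∑' n, ‖b n‖ₑ ≤ 2 * ∑' n, ‖f n‖ₑ := by
    calc ∑' n, ‖b n‖ₑ ≤ ∑' n, (‖f n‖ₑ + ‖g n‖ₑ) := ENNReal.tsum_le_tsum fun n => enorm_sub_le
      _ = ∑' n, ‖f n‖ₑ + ∑' n, ‖g n‖ₑ := ENNReal.tsum_add
      _ ≤ 2 * ∑' n, ‖f n‖ₑ := by rw [two_mul]; gcongr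
  set E : Set (Fin d → ℤ) := {n | t < a n} with hEdef
  have hE : ∀ n ∈ E, ∀ x ∈ dyadicCube (κ n) n, x ∈ E := fun n hn x hx => by
    simp only [hEdef, Set.mem_ofPred_eq, hadef] at hn ⊢
    rwa [hQ n x hx]
  have hbE : ∀ n, n ∉ E → b n = 0 := fun n hn => by
    have hκ0 : κ n = 0 := by
      by_contra h
      exact hn (hsel n h)
    simp [hbdef, hgdef, hQdef, hκ0, dyadicCube_zero]
  set E' : Set (Fin d → ℤ) := {n | ∃ k ∈ E, ‖n - dyadicCorner (κ k) k‖ < 4 * 2 ^ κ k} with hE'def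
  have hE' : t * Measure.count E' ≤ 8 ^ d * ∑' n, ‖f n‖ₑ := by
    calc t * Measure.count E' ≤ t * (8 ^ d * Measure.count E) := by
          gcongr
          exact count_enlargement_le hκ E hE
      _ = 8 ^ d * (t * Measure.count E) := by ring
      _ ≤ 8 ^ d * ∑' n, a n := by
          gcongr
          exact mul_count_le_tsum fun n hn => le_of_lt hn
      _ = _ := by rw [hsum_a]
  have hgood : t * Measure.count {n | t < ‖latticeConv K g n‖ₑ} ≤
      A * 2 ^ d * ∑' n, ‖f n‖ₑ := by
    have h1 : t * (t * Measure.count {n | t < ‖latticeConv K g n‖ₑ}) ≤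
        t * (A * 2 ^ d * ∑' n, ‖f n‖ₑ) := by
      calc t * (t * Measure.count {n | t < ‖latticeConv K g n‖ₑ})
          = t ^ 2 * Measure.count {n | t < ‖latticeConv K g n‖ₑ} := by ring
        _ ≤ ∑' n, ‖latticeConv K g n‖ₑ ^ 2 :=
            mul_count_le_tsum fun n hn => by gcongr; exact le_of_lt hn
        _ ≤ A * ∑' n, ‖g n‖ₑ ^ 2 := hL2 g hg
        _ ≤ A * ∑' n, 2 ^ d * t * ‖g n‖ₑ := by
            gcongr with n
            rw [sq]
            gcongr
            exact (hga n).trans (havg n)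
        _ = A * (2 ^ d * t * ∑' n, ‖g n‖ₑ) := by rw [ENNReal.tsum_mul_left]
        _ ≤ A * (2 ^ d * t * ∑' n, ‖f n‖ₑ) := by gcongr
        _ = t * (A * 2 ^ d * ∑' n, ‖f n‖ₑ) := by ring
    exact (ENNReal.mul_le_mul_iff_right ht ht').1 h1
  have hconv_b : ∀ n, ‖latticeConv K b n‖ₑ ≤ ∑' k, ‖b k‖ₑ * ‖K (n - k) - K (n - c k)‖ₑ := by
    intro n
    have hG : Summable fun k => ‖f k * K (n - c k)‖ :=
      (summable_mul_of_bounded (g := fun k => K (n - c k)) hf fun k => hB _).norm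
    have h0 : ∑' k, b k * K (n - c k) = 0 := by
      have h1 := tsum_average_eq_complex hself hQ hG.of_norm.norm
      have h2 : ∀ k, ((Q k).card : ℂ)⁻¹ * ∑ x ∈ Q k, f x * K (n - c x) = g k * K (n - c k) := by
        intro k
        rw [Finset.sum_congr rfl (g := fun x => f x * K (n - c k)) fun x hx => by rw [hc k x hx],
          ← Finset.sum_mul, ← mul_assoc]
      simp only [h2] at h1
      simp only [hbdef, sub_mul]
      rw [Summable.tsum_sub hG.of_norm (summable_mul_of_bounded hg fun k => hB _), h1, sub_self]
    have h3 : latticeConv K b n = ∑' k, b k * (K (n - k) - K (n - c k)) := by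
      simp only [mul_sub]
      rw [Summable.tsum_sub (summable_mul_of_bounded hb fun k => hB _)
        (summable_mul_of_bounded hb fun k => hB _), h0, sub_zero, latticeConv]
    rw [h3]
    refine (enorm_tsum_le_tsum_enorm ).trans ?_
    simp only [enorm_mul]
    exact le_rfl
  have hbad : t * Measure.count {n | n ∉ E' ∧ t < ‖latticeConv K b n‖ₑ} ≤
      2 * H * ∑' n, ‖f n‖ₑ := by
    calc t * Measure.count {n | n ∉ E' ∧ t < ‖latticeConv K b n‖ₑ}
        ≤ ∑' n, ∑' k, ‖b k‖ₑ * E'ᶜ.indicator (fun n => ‖K (n - k) - K (n - c k)‖ₑ) n := by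
          refine mul_count_le_tsum fun n hn => ?_
          have hn' : n ∈ E'ᶜ := hn.1
          simp only [Set.indicator_of_mem hn']
          exact hn.2.le.trans (hconv_b n)
      _ = ∑' k, ∑' n, ‖b k‖ₑ * E'ᶜ.indicator (fun n => ‖K (n - k) - K (n - c k)‖ₑ) n :=
          ENNReal.tsum_comm
      _ ≤ ∑' k, ‖b k‖ₑ * H := by
          refine ENNReal.tsum_le_tsum fun k => ?_
          rw [ENNReal.tsum_mul_left]
          by_cases hk : k ∈ E
          · gcongr
            refine le_trans ?_ (hH (κ k) (k - c k) (norm_sub_dyadicCorner_lt _ _))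
            rw [← (Equiv.addRight (c k)).tsum_eq]
            refine ENNReal.tsum_le_tsum fun n => ?_
            by_cases hn : n + c k ∈ E'
            · simp [hn]
            · have h4 : 4 * 2 ^ κ k ≤ ‖n‖ := by
                by_contra h
                exact hn ⟨k, hk, by simpa [hcdef] using h⟩
              simp [hn, h4, sub_sub_eq_add_sub]
          · simp [hbE k hk]
      _ = (∑' k, ‖b k‖ₑ) * H := ENNReal.tsum_mul_right
      _ ≤ (2 * ∑' n, ‖f n‖ₑ) * H := by gcongr
      _ = _ := by ring
  have hadd : ∀ n, latticeConv K f n = latticeConv K g n + latticeConv K b n := fun n => by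
    rw [latticeConv, latticeConv, latticeConv, ← Summable.tsum_add
      (summable_mul_of_bounded hg fun k => hB _) (summable_mul_of_bounded hb fun k => hB _)]
    exact tsum_congr fun k => by simp only [hbdef]; ring
  have hsubset : {n | 2 * t < ‖latticeConv K f n‖ₑ} ⊆
      E' ∪ {n | t < ‖latticeConv K g n‖ₑ} ∪ {n | n ∉ E' ∧ t < ‖latticeConv K b n‖ₑ} := by
    intro n hn
    by_contra hcon
    simp only [Set.mem_union, Set.mem_ofPred_eq, not_or, not_and, not_lt] at hcon hn
    obtain ⟨⟨h1, h2⟩, h3⟩ := hcon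
    refine absurd hn (not_lt.2 ?_)
    rw [hadd, two_mul]
    exact (enorm_add_le _ _).trans (add_le_add h2 (h3 h1))
  calc t * Measure.count {n | 2 * t < ‖latticeConv K f n‖ₑ}
      ≤ t * (Measure.count E' + Measure.count {n | t < ‖latticeConv K g n‖ₑ} +
          Measure.count {n | n ∉ E' ∧ t < ‖latticeConv K b n‖ₑ}) := by
        gcongr
        exact (measure_mono hsubset).trans ((measure_union_le _ _).trans
          (by gcongr; exact measure_union_le _ _))
    _ = t * Measure.count E' + t * Measure.count {n | t < ‖latticeConv K g n‖ₑ} +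
          t * Measure.count {n | n ∉ E' ∧ t < ‖latticeConv K b n‖ₑ} := by ring
    _ ≤ 8 ^ d * ∑' n, ‖f n‖ₑ + A * 2 ^ d * ∑' n, ‖f n‖ₑ + 2 * H * ∑' n, ‖f n‖ₑ := by gcongr
    _ = _ := by ring

end WeakType

section Interpolation

variable {ι : Type*}

lemma lintegral_rpow_Ioo_le {p a : ℝ} (hp : 1 < p) (ha : 0 ≤ a) :
    ∫⁻ t in Set.Ioi (0 : ℝ), (Set.Iio a).indicator (fun t => ENNReal.ofReal (t ^ (p - 2))) t *
      ENNReal.ofReal a ≤ ENNReal.ofReal (p - 1)⁻¹ * ENNReal.ofReal (a ^ p) := by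
  have hmeas : Measurable fun t : ℝ => ENNReal.ofReal (t ^ (p - 2)) := by fun_prop
  rw [lintegral_mul_const _ (hmeas.indicator measurableSet_Iio),
    lintegral_indicator measurableSet_Iio, Measure.restrict_restrict measurableSet_Iio,
    Set.Iio_inter_Ioi, Measure.restrict_congr_set Ioo_ae_eq_Ioc,
    ← ofReal_integral_eq_lintegral_ofReal]
  · rw [← intervalIntegral.integral_of_le ha, integral_rpow (Or.inl (by linarith)),
      ← ENNReal.ofReal_mul, ← ENNReal.ofReal_mul (by simp; linarith)]
    · apply ENNReal.ofReal_le_ofReal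
      rw [Real.zero_rpow (by linarith), show p - 2 + 1 = p - 1 by ring, sub_zero,
        Real.rpow_sub_one' ha (by linarith)]
      rcases ha.eq_or_lt with rfl | h
      · rw [Real.zero_rpow (by linarith)]; simp
      · field_simp
        exact le_rfl
    · rw [Real.zero_rpow (by linarith), sub_zero]
      have : 0 < p - 2 + 1 := by linarith
      positivity
  · have := (intervalIntegral.intervalIntegrable_rpow' (a := 0) (b := a) (r := p - 2)
      (by linarith)).1
    exact this
  · filter_upwards [ae_restrict_mem measurableSet_Ioc] with t ht
    have := ht.1
    simp only [Pi.zero_apply]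
    positivity

lemma lintegral_rpow_Ici_le {p a : ℝ} (hp2 : p < 2) (ha : 0 ≤ a) :
    ∫⁻ t in Set.Ioi (0 : ℝ), (Set.Ici a).indicator (fun t => ENNReal.ofReal (t ^ (p - 3))) t *
      ENNReal.ofReal (a ^ 2) ≤ ENNReal.ofReal (2 - p)⁻¹ * ENNReal.ofReal (a ^ p) := by
  have hmeas : Measurable fun t : ℝ => ENNReal.ofReal (t ^ (p - 3)) := by fun_prop
  rcases ha.eq_or_lt with rfl | h
  · simp
  rw [lintegral_mul_const _ (hmeas.indicator measurableSet_Ici),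
    lintegral_indicator measurableSet_Ici, Measure.restrict_restrict measurableSet_Ici,
    Set.inter_eq_left.2 (Set.Ici_subset_Ioi.2 h), Measure.restrict_congr_set Ioi_ae_eq_Ici.symm,
    ← ofReal_integral_eq_lintegral_ofReal (integrableOn_Ioi_rpow_of_lt (by linarith) h)]
  · rw [integral_Ioi_rpow_of_lt (by linarith) h, ← ENNReal.ofReal_mul,
      ← ENNReal.ofReal_mul (by simp; linarith)]
    · apply ENNReal.ofReal_le_ofReal
      have h1 : a ^ (p - 3 + 1) = a ^ p / a ^ 2 := by
        rw [show p - 3 + 1 = p - (2 : ℕ) by push_cast; ring, Real.rpow_sub_natCast h.ne']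
      rw [h1]
      have h2 : (2 - p) ≠ 0 := by linarith
      have h3 : (p - 3 + 1) = -(2 - p) := by ring
      rw [h3]
      field_simp
      exact le_rfl
    · apply div_nonneg_of_nonpos
      · simp only [neg_nonpos]; positivity
      · linarith
  · filter_upwards [ae_restrict_mem measurableSet_Ioi] with t ht
    have : 0 < t := h.trans ht
    simp only [Pi.zero_apply]
    positivity

lemma ofReal_rpow_norm (z : ℂ) {p : ℝ} (hp : 0 ≤ p) : ENNReal.ofReal (‖z‖ ^ p) = ‖z‖ₑ ^ p := by
  rw [← ENNReal.ofReal_rpow_of_nonneg (norm_nonneg _) hp, ofReal_norm]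

/-- Marcinkiewicz interpolation between weak type `(1,1)` and strong type `(2,2)` on a countable
discrete space. -/
theorem strongType_of_weakType [MeasurableSpace ι] [DiscreteMeasurableSpace ι] [Countable ι]
    {T : (ι → ℂ) → ι → ℂ}
    (hadd : ∀ f g : ι → ℂ, Summable (fun n => ‖f n‖) → Summable (fun n => ‖g n‖) →
      T (fun n => f n + g n) = fun n => T f n + T g n) {W A : ℝ≥0∞}
    (hL2 : ∀ f : ι → ℂ, Summable (fun n => ‖f n‖) →
      ∑' n, ‖T f n‖ₑ ^ 2 ≤ A * ∑' n, ‖f n‖ₑ ^ 2)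
    (hweak : ∀ f : ι → ℂ, Summable (fun n => ‖f n‖) → ∀ t : ℝ≥0∞, t ≠ 0 → t ≠ ∞ →
      t * Measure.count {n | 2 * t < ‖T f n‖ₑ} ≤ W * ∑' n, ‖f n‖ₑ)
    {p : ℝ} (hp : 1 < p) (hp2 : p < 2) {f : ι → ℂ} (hf : Summable fun n => ‖f n‖) :
    ∑' n, ‖T f n‖ₑ ^ p ≤ ENNReal.ofReal (4 ^ p) * (ENNReal.ofReal p *
      (W * ENNReal.ofReal (p - 1)⁻¹ + A * ENNReal.ofReal (2 - p)⁻¹)) * ∑' n, ‖f n‖ₑ ^ p := by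
  classical
  have hlevel : ∀ t : ℝ, 0 < t → Measure.count {n | t < ‖T f n‖ / 4} *
      ENNReal.ofReal (t ^ (p - 1)) ≤
      ∑' n, (W * ((Set.Iio ‖f n‖).indicator (fun t => ENNReal.ofReal (t ^ (p - 2))) t *
        ENNReal.ofReal ‖f n‖) + A * ((Set.Ici ‖f n‖).indicator
          (fun t => ENNReal.ofReal (t ^ (p - 3))) t * ENNReal.ofReal (‖f n‖ ^ 2))) := by
    intro t ht
    set f₁ : ι → ℂ := fun n => if t < ‖f n‖ then f n else 0 with hf₁
    set f₂ : ι → ℂ := fun n => if t < ‖f n‖ then 0 else f n with hf₂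
    have hs₁ : Summable fun n => ‖f₁ n‖ := hf.of_nonneg_of_le (fun _ => norm_nonneg _) fun n => by
      simp only [hf₁]; split_ifs <;> simp
    have hs₂ : Summable fun n => ‖f₂ n‖ := hf.of_nonneg_of_le (fun _ => norm_nonneg _) fun n => by
      simp only [hf₂]; split_ifs <;> simp
    have hT : T f = fun n => T f₁ n + T f₂ n := by
      rw [← hadd f₁ f₂ hs₁ hs₂]
      congr 1
      funext n
      simp only [hf₁, hf₂]; split_ifs <;> simp
    set τ := ENNReal.ofReal t with hτ
    have hτ0 : τ ≠ 0 := by simpa [hτ] using ht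
    have hτ' : τ ≠ ∞ := ENNReal.ofReal_ne_top
    have hsub : {n | t < ‖T f n‖ / 4} ⊆
        {n | 2 * τ < ‖T f₁ n‖ₑ} ∪ {n | 2 * τ < ‖T f₂ n‖ₑ} := by
      intro n hn
      by_contra hcon
      simp only [Set.mem_union, Set.mem_ofPred_eq, not_or, not_lt] at hcon hn
      have h2 : (2 : ℝ≥0∞) * τ = ENNReal.ofReal (2 * t) := by
        rw [ENNReal.ofReal_mul zero_le_two]; simp [hτ]
      rw [h2, ← ofReal_norm, ← ofReal_norm, ENNReal.ofReal_le_ofReal_iff (by positivity),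
        ENNReal.ofReal_le_ofReal_iff (by positivity)] at hcon
      have := norm_add_le (T f₁ n) (T f₂ n)
      rw [hT] at hn
      simp only at hn
      linarith [hcon.1, hcon.2]
    have hw : τ * Measure.count {n | 2 * τ < ‖T f₁ n‖ₑ} ≤ W * ∑' n, ‖f₁ n‖ₑ :=
      hweak f₁ hs₁ τ hτ0 hτ'
    have hs : τ ^ 2 * Measure.count {n | 2 * τ < ‖T f₂ n‖ₑ} ≤ A * ∑' n, ‖f₂ n‖ₑ ^ 2 := by
      refine le_trans (mul_count_le_tsum fun n hn => ?_) (hL2 f₂ hs₂)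
      gcongr
      refine le_trans ?_ (le_of_lt hn)
      rw [two_mul]; exact le_self_add
    have hpow1 : ENNReal.ofReal (t ^ (p - 1)) = ENNReal.ofReal (t ^ (p - 2)) * τ := by
      rw [hτ, ← ENNReal.ofReal_mul (by positivity), ← Real.rpow_add_one ht.ne']
      congr 2; ring
    have hpow2 : ENNReal.ofReal (t ^ (p - 1)) = ENNReal.ofReal (t ^ (p - 3)) * τ ^ 2 := by
      rw [hτ, ← ENNReal.ofReal_pow ht.le, ← ENNReal.ofReal_mul (by positivity),
        ← Real.rpow_add_natCast ht.ne']
      congr 2; push_cast; ring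
    calc Measure.count {n | t < ‖T f n‖ / 4} * ENNReal.ofReal (t ^ (p - 1))
        ≤ (Measure.count {n | 2 * τ < ‖T f₁ n‖ₑ} + Measure.count {n | 2 * τ < ‖T f₂ n‖ₑ}) *
            ENNReal.ofReal (t ^ (p - 1)) := by
          gcongr
          exact (measure_mono hsub).trans (measure_union_le _ _)
      _ = ENNReal.ofReal (t ^ (p - 2)) * (τ * Measure.count {n | 2 * τ < ‖T f₁ n‖ₑ}) +
          ENNReal.ofReal (t ^ (p - 3)) * (τ ^ 2 * Measure.count {n | 2 * τ < ‖T f₂ n‖ₑ}) := by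
          rw [add_mul]
          nth_rw 1 [hpow1]
          rw [hpow2]
          ring
      _ ≤ ENNReal.ofReal (t ^ (p - 2)) * (W * ∑' n, ‖f₁ n‖ₑ) +
          ENNReal.ofReal (t ^ (p - 3)) * (A * ∑' n, ‖f₂ n‖ₑ ^ 2) := by gcongr
      _ = _ := by
          rw [← ENNReal.tsum_mul_left, ← ENNReal.tsum_mul_left, ← ENNReal.tsum_mul_left,
            ← ENNReal.tsum_mul_left, ← ENNReal.tsum_add]
          refine tsum_congr fun n => ?_
          by_cases hn : t < ‖f n‖
          · simp only [hf₁, hf₂, hn, if_true, Set.mem_Iio, Set.indicator_of_mem, Set.mem_Ici,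
              not_le.2 hn, not_false_eq_true, Set.indicator_of_notMem, enorm_zero, ofReal_norm]
            simp; ring
          · have hn' : ‖f n‖ ≤ t := not_lt.1 hn
            simp only [hf₁, hf₂, hn, if_false, Set.mem_Iio, Set.indicator_of_mem, Set.mem_Ici,
              hn', not_false_eq_true, Set.indicator_of_notMem, enorm_zero,
              ENNReal.ofReal_pow (norm_nonneg _), ofReal_norm]
            simp; ring
  have hcake := lintegral_rpow_eq_lintegral_meas_lt_mul (Measure.count : Measure ι)
    (f := fun n => ‖T f n‖ / 4) (Filter.Eventually.of_forall fun n => by positivity)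
    (measurable_of_countable _).aemeasurable (p := p) (by linarith)
  have hmeas1 : ∀ n, Measurable fun t : ℝ =>
      (Set.Iio ‖f n‖).indicator (fun t => ENNReal.ofReal (t ^ (p - 2))) t *
        ENNReal.ofReal ‖f n‖ := fun n =>
    (Measurable.indicator (by fun_prop) measurableSet_Iio).mul_const _
  have hmeas2 : ∀ n, Measurable fun t : ℝ =>
      (Set.Ici ‖f n‖).indicator (fun t => ENNReal.ofReal (t ^ (p - 3))) t *
        ENNReal.ofReal (‖f n‖ ^ 2) := fun n =>
    (Measurable.indicator (by fun_prop) measurableSet_Ici).mul_const _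
  have hmeas : ∀ n, Measurable fun t : ℝ =>
      W * ((Set.Iio ‖f n‖).indicator (fun t => ENNReal.ofReal (t ^ (p - 2))) t *
        ENNReal.ofReal ‖f n‖) + A * ((Set.Ici ‖f n‖).indicator
          (fun t => ENNReal.ofReal (t ^ (p - 3))) t * ENNReal.ofReal (‖f n‖ ^ 2)) := fun n =>
    ((hmeas1 n).const_mul W).add ((hmeas2 n).const_mul A)
  calc ∑' n, ‖T f n‖ₑ ^ p
      = ENNReal.ofReal (4 ^ p) * ∫⁻ n, ENNReal.ofReal ((‖T f n‖ / 4) ^ p) ∂Measure.count := by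
        rw [lintegral_count, ← ENNReal.tsum_mul_left]
        refine tsum_congr fun n => ?_
        rw [← ENNReal.ofReal_mul (by positivity), ← Real.mul_rpow (by positivity) (by positivity),
          mul_div_cancel₀ _ (by norm_num), ofReal_rpow_norm _ (by linarith)]
    _ ≤ ENNReal.ofReal (4 ^ p) * (ENNReal.ofReal p * ∫⁻ t in Set.Ioi (0 : ℝ), ∑' n,
        (W * ((Set.Iio ‖f n‖).indicator (fun t => ENNReal.ofReal (t ^ (p - 2))) t *
        ENNReal.ofReal ‖f n‖) + A * ((Set.Ici ‖f n‖).indicator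
          (fun t => ENNReal.ofReal (t ^ (p - 3))) t * ENNReal.ofReal (‖f n‖ ^ 2)))) := by
        rw [hcake]
        gcongr 2
        exact setLIntegral_mono' measurableSet_Ioi hlevel
    _ ≤ ENNReal.ofReal (4 ^ p) * (ENNReal.ofReal p * ∑' n,
        (W * (ENNReal.ofReal (p - 1)⁻¹ * ENNReal.ofReal (‖f n‖ ^ p)) +
          A * (ENNReal.ofReal (2 - p)⁻¹ * ENNReal.ofReal (‖f n‖ ^ p)))) := by
        gcongr 2
        rw [lintegral_tsum fun n => (hmeas n).aemeasurable]
        refine ENNReal.tsum_le_tsum fun n => ?_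
        rw [lintegral_add_left ((hmeas1 n).const_mul W), lintegral_const_mul _ (hmeas1 n),
          lintegral_const_mul _ (hmeas2 n)]
        gcongr
        · exact lintegral_rpow_Ioo_le hp (norm_nonneg _)
        · exact lintegral_rpow_Ici_le hp2 (norm_nonneg _)
    _ = _ := by
        simp only [ofReal_rpow_norm _ (show 0 ≤ p by linarith)]
        rw [ENNReal.tsum_add, ENNReal.tsum_mul_left, ENNReal.tsum_mul_left, ENNReal.tsum_mul_left,
          ENNReal.tsum_mul_left]
        ring

end Interpolation

section Duality

variable {d : ℕ}

/-- Duality for convolution operators on `ℤ^d`. -/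
theorem latticeConv_strongType_dual {K : (Fin d → ℤ) → ℂ} {B : ℝ} (hB : ∀ n, ‖K n‖ ≤ B)
    {p q : ℝ} (hpq : p.HolderConjugate q) {C : ℝ≥0∞}
    (hC : ∀ g : (Fin d → ℤ) → ℂ, Summable (fun n => ‖g n‖) →
      ∑' n, ‖latticeConv (fun n => K (-n)) g n‖ₑ ^ q ≤ C * ∑' n, ‖g n‖ₑ ^ q)
    {f : (Fin d → ℤ) → ℂ} (hf : Summable fun n => ‖f n‖) :
    ∑' n, ‖latticeConv K f n‖ₑ ^ p ≤ (C ^ (1 / q)) ^ p * ∑' n, ‖f n‖ₑ ^ p := by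
  classical
  have hp0 := hpq.pos
  have hq0 := hpq.symm.pos
  rw [ENNReal.tsum_eq_iSup_sum]
  refine iSup_le fun F => ?_
  set T := latticeConv K f with hT
  set g : (Fin d → ℤ) → ℂ := fun n =>
    if n ∈ F then (starRingEnd ℂ) (T n) * ((‖T n‖ ^ (p - 2) : ℝ) : ℂ) else 0 with hg
  have hgs : Summable fun n => ‖g n‖ :=
    summable_of_ne_finset_zero (s := F) fun n hn => by simp [hg, hn]
  have hTg : ∀ n ∈ F, T n * g n = ((‖T n‖ ^ p : ℝ) : ℂ) := by
    intro n hn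
    simp only [hg, hn, if_true]
    rw [← mul_assoc, Complex.mul_conj, Complex.normSq_eq_norm_sq]
    rcases eq_or_ne (T n) 0 with h | h
    · simp [h, Real.zero_rpow hp0.ne']
    · rw [← Complex.ofReal_mul, ← Real.rpow_natCast, ← Real.rpow_add (by positivity)]
      congr 2; push_cast; ring
  have hgq : ∀ n ∈ F, ‖g n‖ₑ ^ q = ‖T n‖ₑ ^ p := by
    intro n hn
    rw [← ofReal_rpow_norm _ hq0.le, ← ofReal_rpow_norm _ hp0.le]
    congr 1
    simp only [hg, hn, if_true]
    rcases eq_or_ne (T n) 0 with h | h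
    · simp [h, Real.zero_rpow hp0.ne', Real.zero_rpow hq0.ne']
    · have h0 : 0 < ‖T n‖ := norm_pos_iff.2 h
      rw [norm_mul, RCLike.norm_conj, Complex.norm_real, Real.norm_of_nonneg (by positivity)]
      nth_rw 1 [← Real.rpow_one ‖T n‖]
      rw [← Real.rpow_add h0, ← Real.rpow_mul h0.le]
      congr 1
      have := hpq.sub_one_mul_conj
      linear_combination this
  have hgq0 : ∀ n ∉ F, ‖g n‖ₑ ^ q = 0 := fun n hn => by simp [hg, hn, hq0]
  set X := ∑ n ∈ F, ‖T n‖ₑ ^ p with hX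
  have hXg : ∑' n, ‖g n‖ₑ ^ q = X := by
    rw [tsum_eq_sum hgq0]
    exact Finset.sum_congr rfl hgq
  have hXtop : X ≠ ∞ := by
    simp only [hX]
    exact ENNReal.sum_ne_top.2 fun n _ => by finiteness
  have hswap : ∑ n ∈ F, T n * g n = ∑' k, f k * latticeConv (fun n => K (-n)) g k := by
    have h1 : ∀ k, f k * latticeConv (fun n => K (-n)) g k =
        ∑ n ∈ F, g n * (f k * K (n - k)) := by
      intro k
      rw [latticeConv, tsum_eq_sum (s := F) fun n hn => by simp [hg, hn], Finset.mul_sum]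
      refine Finset.sum_congr rfl fun n _ => ?_
      rw [neg_sub]; ring
    simp only [h1]
    rw [Summable.tsum_finsetSum fun n _ =>
      (summable_mul_of_bounded (g := fun k => K (n - k)) hf fun k => hB _).mul_left _]
    refine Finset.sum_congr rfl fun n _ => ?_
    rw [tsum_mul_left, mul_comm, hT, latticeConv]
  have hXle : X ≤ (∑' n, ‖f n‖ₑ ^ p) ^ (1 / p) * (C * X) ^ (1 / q) := by
    have h1 : X = ‖∑ n ∈ F, T n * g n‖ₑ := by
      rw [Finset.sum_congr rfl hTg, ← Complex.ofReal_sum, ← ofReal_norm, Complex.norm_real,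
        Real.norm_of_nonneg (by positivity),
        ENNReal.ofReal_sum_of_nonneg fun n _ => by positivity]
      exact Finset.sum_congr rfl fun n _ => (ofReal_rpow_norm _ hp0.le).symm
    calc X = ‖∑' k, f k * latticeConv (fun n => K (-n)) g k‖ₑ := by rw [h1, hswap]
      _ ≤ ∑' k, ‖f k‖ₑ * ‖latticeConv (fun n => K (-n)) g k‖ₑ := by
          refine enorm_tsum_le_tsum_enorm.trans ?_
          simp only [enorm_mul]
          exact le_rfl
      _ ≤ (∑' k, ‖f k‖ₑ ^ p) ^ (1 / p) *
          (∑' k, ‖latticeConv (fun n => K (-n)) g k‖ₑ ^ q) ^ (1 / q) := by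
          have := ENNReal.lintegral_mul_le_Lp_mul_Lq (Measure.count : Measure (Fin d → ℤ)) hpq
            (f := fun k => ‖f k‖ₑ) (g := fun k => ‖latticeConv (fun n => K (-n)) g k‖ₑ)
            (measurable_of_countable _).aemeasurable (measurable_of_countable _).aemeasurable
          simpa only [lintegral_count, Pi.mul_apply] using this
      _ ≤ _ := by
          gcongr
          rw [← hXg]
          exact hC g hgs
  rcases eq_or_ne X 0 with h0 | h0
  · rw [h0]; exact zero_le
  have hsplit : X = X ^ (1 / p) * X ^ (1 / q) := by
    rw [← ENNReal.rpow_add _ _ h0 hXtop, one_div, one_div, hpq.inv_add_inv_eq_one,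
      ENNReal.rpow_one]
  have h2 : X ^ (1 / p) ≤ C ^ (1 / q) * (∑' n, ‖f n‖ₑ ^ p) ^ (1 / p) := by
    have hXq0 : X ^ (1 / q) ≠ 0 := by
      simp [ENNReal.rpow_eq_zero_iff, h0, hXtop]
    have hXq' : X ^ (1 / q) ≠ ∞ := ENNReal.rpow_ne_top_of_nonneg (by positivity) hXtop
    rw [← ENNReal.mul_le_mul_iff_left hXq0 hXq', ← hsplit]
    refine hXle.trans (le_of_eq ?_)
    rw [ENNReal.mul_rpow_of_nonneg _ _ (by positivity)]
    ring
  calc X = (X ^ (1 / p)) ^ p := by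
        rw [← ENNReal.rpow_mul, one_div_mul_cancel hp0.ne', ENNReal.rpow_one]
    _ ≤ (C ^ (1 / q) * (∑' n, ‖f n‖ₑ ^ p) ^ (1 / p)) ^ p := by gcongr
    _ = _ := by
        rw [ENNReal.mul_rpow_of_nonneg _ _ hp0.le, ← ENNReal.rpow_mul (∑' n, ‖f n‖ₑ ^ p),
          one_div_mul_cancel hp0.ne', ENNReal.rpow_one]

end Duality

section FiniteDifferences

lemma norm_fwdDiff_iter_le_of_norm_iteratedFDeriv_le {E : Type} [NormedAddCommGroup E]
    [NormedSpace ℝ E] {v : E} {B : ℝ} (s : ℕ) {F : Type} [NormedAddCommGroup F] [NormedSpace ℝ F]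
    {g : E → F} {x : E}
    (hg : ∀ t ∈ Set.Icc (0 : ℝ) s, ContDiffAt ℝ s g (x + t • v))
    (hB : ∀ t ∈ Set.Icc (0 : ℝ) s, ‖iteratedFDeriv ℝ s g (x + t • v)‖ ≤ B) :
    ‖(fwdDiff v)^[s] g x‖ ≤ B * ‖v‖ ^ s := by
  induction s generalizing F g x with
  | zero => simpa using hB 0 (by simp)
  | succ s ih =>
    have hderiv : ∀ t ∈ Set.Icc (0 : ℝ) 1,
        HasFDerivAt ((fwdDiff v)^[s] g) ((fwdDiff v)^[s] (fderiv ℝ g) (x + t • v)) (x + t • v) := by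
      intro t ht
      have h1 : (fwdDiff v)^[s] g = fun y => ∑ k ∈ Finset.range (s + 1),
          ((-1 : ℤ) ^ (s - k) * s.choose k) • g (y + k • v) :=
        funext fun y => fwdDiff_iter_eq_sum_shift _ _ _ _
      rw [h1, fwdDiff_iter_eq_sum_shift]
      refine HasFDerivAt.fun_sum fun k hk => ?_
      have hk' : (k : ℝ) ≤ s := by
        exact_mod_cast Nat.lt_succ_iff.1 (Finset.mem_range.1 hk)
      have h2 : x + t • v + k • v = x + (t + k) • v := by
        rw [add_smul, add_assoc, Nat.cast_smul_eq_nsmul]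
      have h3 : DifferentiableAt ℝ g (x + t • v + k • v) := by
        rw [h2]
        refine (hg _ ⟨by have := ht.1; positivity, ?_⟩).differentiableAt (by simp)
        push_cast
        linarith [ht.2]
      exact ((hasFDerivAt_comp_add_right (k • v)).2 h3.hasFDerivAt).const_smul
        ((-1 : ℤ) ^ (s - k) * s.choose k)
    have hbound : ∀ t ∈ Set.Icc (0 : ℝ) 1,
        ‖(fwdDiff v)^[s] (fderiv ℝ g) (x + t • v)‖ ≤ B * ‖v‖ ^ s := by
      intro t ht
      have key : ∀ t' ∈ Set.Icc (0 : ℝ) s, x + t • v + t' • v = x + (t + t') • v ∧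
          t + t' ∈ Set.Icc (0 : ℝ) ((s + 1 : ℕ) : ℝ) := fun t' ht' =>
        ⟨by rw [add_smul, add_assoc], by linarith [ht.1, ht'.1], by
          push_cast; linarith [ht.2, ht'.2]⟩
      refine ih (fun t' ht' => ?_) (fun t' ht' => ?_)
      · rw [(key t' ht').1]
        exact (hg _ (key t' ht').2).fderiv_right (by norm_cast)
      · rw [(key t' ht').1, norm_iteratedFDeriv_fderiv]
        exact hB _ (key t' ht').2
    have hmem : ∀ y ∈ segment ℝ x (x + v), ∃ t ∈ Set.Icc (0 : ℝ) 1, y = x + t • v := by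
      intro y hy
      rw [segment_eq_image'] at hy
      obtain ⟨t, ht, rfl⟩ := hy
      exact ⟨t, ht, by simp⟩
    choose! τ hτ hτ' using hmem
    have := (convex_segment x (x + v)).norm_image_sub_le_of_norm_hasFDerivWithin_le (𝕜 := ℝ)
      (f := (fwdDiff v)^[s] g) (f' := fun y => (fwdDiff v)^[s] (fderiv ℝ g) y)
      (C := B * ‖v‖ ^ s) (fun y hy => ?_) (fun y hy => ?_) (left_mem_segment ℝ x (x + v))
      (right_mem_segment ℝ x (x + v))
    · rw [Function.iterate_succ_apply', fwdDiff]
      refine this.trans (le_of_eq ?_)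
      rw [add_sub_cancel_left, pow_succ]
      ring
    · rw [hτ' y hy]
      exact (hderiv _ (hτ y hy)).hasFDerivWithinAt
    · rw [hτ' y hy]
      exact hbound _ (hτ y hy)

lemma norm_fwdDiff_iter_le_of_norm_le {E F : Type*} [AddCommGroup E] [NormedAddCommGroup F]
    {g : E → F} {v x : E} {B : ℝ} (s : ℕ) (hB : ∀ k ≤ s, ‖g (x + k • v)‖ ≤ B) :
    ‖(fwdDiff v)^[s] g x‖ ≤ 2 ^ s * B := by
  induction s generalizing x with
  | zero => simpa using hB 0 le_rfl
  | succ s ih =>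
    rw [Function.iterate_succ_apply', fwdDiff]
    have h1 := ih (x := x) fun k hk => hB k (hk.trans s.le_succ)
    have h2 := ih (x := x + v) fun k hk => by
      have := hB (k + 1) (Nat.succ_le_succ hk)
      rwa [succ_nsmul', ← add_assoc] at this
    calc _ ≤ _ := norm_sub_le _ _
      _ ≤ 2 ^ s * B + 2 ^ s * B := add_le_add h2 h1
      _ = _ := by ring

end FiniteDifferences

section LatticeDistance

variable {d : ℕ}

/-- The sup-norm distance from `ξ` to the integer lattice. -/
noncomputable def latticeDist (ξ : Fin d → ℝ) : ℝ := ‖fun i => ξ i - round (ξ i)‖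

lemma latticeDist_nonneg (ξ : Fin d → ℝ) : 0 ≤ latticeDist ξ := norm_nonneg _

lemma abs_sub_round_le_latticeDist (ξ : Fin d → ℝ) (i : Fin d) :
    |ξ i - round (ξ i)| ≤ latticeDist ξ :=
  norm_le_pi_norm (fun i => ξ i - (round (ξ i) : ℝ)) i

lemma latticeDist_le_one (ξ : Fin d → ℝ) : latticeDist ξ ≤ 1 := by
  refine (pi_norm_le_iff_of_nonneg zero_le_one).2 fun i => ?_
  exact (abs_sub_round (ξ i)).trans (by norm_num)

lemma latticeDist_le_norm_sub (ξ : Fin d → ℝ) (n : Fin d → ℤ) :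
    latticeDist ξ ≤ ‖ξ - fun i => (n i : ℝ)‖ := by
  refine (pi_norm_le_iff_of_nonneg (norm_nonneg _)).2 fun i => ?_
  exact (round_le (ξ i) (n i)).trans (norm_le_pi_norm (ξ - fun i => (n i : ℝ)) i)

lemma latticeDist_le_add (ξ v : Fin d → ℝ) : latticeDist ξ ≤ latticeDist (ξ + v) + ‖v‖ := by
  refine (latticeDist_le_norm_sub ξ fun i => round ((ξ + v) i)).trans ?_
  calc ‖ξ - fun i => (round ((ξ + v) i) : ℝ)‖
      = ‖(fun i => (ξ + v) i - (round ((ξ + v) i) : ℝ)) - v‖ := by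
        congr 1; funext i; simp; ring
    _ ≤ _ := norm_sub_le _ _

lemma latticeDist_add_le (ξ v : Fin d → ℝ) : latticeDist (ξ + v) ≤ latticeDist ξ + ‖v‖ := by
  simpa using latticeDist_le_add (ξ + v) (-v)

lemma mem_latticeComp_iff (ξ : Fin d → ℝ) : ξ ∈ latticeComp d ↔ 0 < latticeDist ξ := by
  rw [(latticeDist_nonneg ξ).lt_iff_ne', Ne, latticeDist, norm_eq_zero, latticeComp,
    Set.mem_ofPred_eq, not_iff_not]
  constructor
  · rintro ⟨n, rfl⟩
    funext i
    simp
  · intro h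
    exact ⟨fun i => round (ξ i), funext fun i => sub_eq_zero.1 (congrFun h i)⟩

lemma isOpen_latticeComp : IsOpen (latticeComp d) := by
  have hcont : Continuous (latticeDist : (Fin d → ℝ) → ℝ) := by
    refine (LipschitzWith.of_dist_le_mul (K := 1) fun ξ η => ?_).continuous
    have h1 := latticeDist_add_le η (ξ - η)
    have h2 := latticeDist_le_add η (ξ - η)
    rw [add_sub_cancel] at h1 h2
    rw [Real.dist_eq, dist_eq_norm, NNReal.coe_one, one_mul, abs_le]
    constructor <;> linarith
  have : latticeComp d = latticeDist ⁻¹' Set.Ioi 0 := by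
    ext ξ
    exact mem_latticeComp_iff ξ
  rw [this]
  exact isOpen_Ioi.preimage hcont

end LatticeDistance

section Mikhlin

variable {d : ℕ}

lemma iteratedFDeriv_eq_of_periodic {F : Type*} [NormedAddCommGroup F] [NormedSpace ℝ F]
    {g : (Fin d → ℝ) → F}
    (hg : ∀ (ξ : Fin d → ℝ) (n : Fin d → ℤ), g (ξ + fun i => (n i : ℝ)) = g ξ)
    (k : ℕ) (ξ : Fin d → ℝ) :
    iteratedFDeriv ℝ k g ξ = iteratedFDeriv ℝ k g fun i => ξ i - round (ξ i) := by
  have h1 : (fun x : Fin d → ℝ => g (x + fun i => (round (ξ i) : ℝ))) = g :=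
    funext fun x => hg x _
  have h2 := iteratedFDeriv_comp_add_right (𝕜 := ℝ) (f := g) k (fun i => (round (ξ i) : ℝ))
    (fun i => ξ i - round (ξ i))
  rw [h1] at h2
  rw [h2]
  congr 1
  funext i
  simp

lemma exists_norm_iteratedFDeriv_le_of_periodic {F : Type*} [NormedAddCommGroup F]
    [NormedSpace ℝ F] {g : (Fin d → ℝ) → F}
    (hg : ∀ (ξ : Fin d → ℝ) (n : Fin d → ℤ), g (ξ + fun i => (n i : ℝ)) = g ξ) {N : ℕ}
    (hsmooth : ContDiff ℝ N g) :
    ∃ U : ℝ, 0 ≤ U ∧ ∀ k ≤ N, ∀ ξ, ‖iteratedFDeriv ℝ k g ξ‖ ≤ U := by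
  have h1 : ∀ k ≤ N, ∃ U : ℝ, ∀ ξ ∈ Metric.closedBall (0 : Fin d → ℝ) 1,
      ‖iteratedFDeriv ℝ k g ξ‖ ≤ U := fun k hk =>
    (isCompact_closedBall _ _).exists_bound_of_continuousOn
      (hsmooth.continuous_iteratedFDeriv (by exact_mod_cast hk)).continuousOn
  choose! U hU using h1
  refine ⟨∑ k ∈ Finset.range (N + 1), |U k|, Finset.sum_nonneg fun _ _ => abs_nonneg _,
    fun k hk ξ => ?_⟩
  rw [iteratedFDeriv_eq_of_periodic hg]
  refine (hU k hk _ ?_).trans ((le_abs_self _).trans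
    (Finset.single_le_sum (f := fun k => |U k|) (fun _ _ => abs_nonneg _)
      (Finset.mem_range.2 (Nat.lt_succ_iff.2 hk))))
  rw [mem_closedBall_zero_iff]
  exact latticeDist_le_one ξ

lemma norm_le_euclNorm (ξ : Fin d → ℝ) : ‖ξ‖ ≤ euclNorm d ξ := by
  refine (pi_norm_le_iff_of_nonneg (Real.sqrt_nonneg _)).2 fun i => ?_
  rw [Real.norm_eq_abs]
  refine Real.abs_le_sqrt ?_
  exact Finset.single_le_sum (f := fun i => ξ i ^ 2) (fun _ _ => sq_nonneg _) (Finset.mem_univ i)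

lemma latticeDist_pow_mul_norm_iteratedFDeriv_le {m : (Fin d → ℝ) → ℂ} {N : ℕ} {c : ℝ}
    (hper : ∀ (ξ : Fin d → ℝ) (n : Fin d → ℤ), m (ξ + fun i => (n i : ℝ)) = m ξ)
    (hsmooth : ContDiffOn ℝ N m (latticeComp d)) {k : ℕ} (hk : k ≤ N)
    (hmik : ∀ ξ ∈ Set.univ.pi fun _ : Fin d => Set.Ioo (-(1/2) : ℝ) (1/2), ξ ≠ 0 →
        ‖iteratedFDerivWithin ℝ k m (latticeComp d) ξ‖ ≤ c * euclNorm d ξ ^ (-(k : ℝ)))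
    {ξ : Fin d → ℝ} (hξ : ξ ∈ latticeComp d) :
    latticeDist ξ ^ k * ‖iteratedFDeriv ℝ k m ξ‖ ≤ c := by
  rw [iteratedFDeriv_eq_of_periodic hper]
  have hpos := (mem_latticeComp_iff ξ).1 hξ
  unfold latticeDist at hpos ⊢
  set η : Fin d → ℝ := fun i => ξ i - round (ξ i) with hη
  have hη' : η ∈ latticeComp d := by
    rintro ⟨n, hn⟩
    refine hξ ⟨fun i => n i + round (ξ i), funext fun i => ?_⟩
    have := congrFun hn i
    simp only [hη] at this
    push_cast
    linarith
  have hcont : ContinuousAt (fun t : ℝ => ‖t • η‖ ^ k * ‖iteratedFDeriv ℝ k m (t • η)‖) 1 := by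
    have h1 : ContinuousAt (iteratedFDeriv ℝ k m) ((1 : ℝ) • η) := by
      rw [one_smul]
      exact ((hsmooth.contDiffAt (isOpen_latticeComp.mem_nhds hη')).iteratedFDeriv_right
        (m := 0) (i := k) (by simpa using hk)).continuousAt
    have h2 : ContinuousAt (fun t : ℝ => t • η) 1 := by fun_prop
    exact (h2.norm.pow k).mul (ContinuousAt.comp (f := fun t : ℝ => t • η) h1 h2).norm
  have hlim := hcont.tendsto.mono_left (nhdsWithin_le_nhds (s := Set.Iio 1))
  rw [one_smul] at hlim
  refine le_of_tendsto hlim ?_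
  filter_upwards [Ioo_mem_nhdsLT (zero_lt_one' ℝ)] with t ht
  have hlt : ∀ i, |t * η i| < 1 / 2 := fun i => by
    rw [abs_mul, abs_of_pos ht.1]
    have := abs_sub_round (ξ i)
    nlinarith [ht.1, ht.2, abs_nonneg (η i)]
  have hne : t • η ≠ 0 := smul_ne_zero ht.1.ne' (norm_pos_iff.1 hpos)
  have hmem : t • η ∈ latticeComp d := by
    rintro ⟨n, hn⟩
    refine hne (funext fun i => ?_)
    have h1 := congrFun hn i
    have h2 := hlt i
    simp only [Pi.smul_apply, smul_eq_mul] at h1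
    rw [h1] at h2
    have h3 : |n i| < 1 := by
      have : (|n i| : ℝ) < 1 := h2.trans (by norm_num)
      exact_mod_cast this
    simp [h1, Int.abs_lt_one_iff.1 h3]
  have := hmik (t • η) (fun i _ => abs_lt.1 (hlt i)) hne
  rw [iteratedFDerivWithin_of_isOpen _ isOpen_latticeComp hmem] at this
  have hpos' : 0 < ‖t • η‖ := norm_pos_iff.2 hne
  have hle := norm_le_euclNorm (t • η)
  calc _ ≤ euclNorm d (t • η) ^ k * (c * euclNorm d (t • η) ^ (-(k : ℝ))) :=
        mul_le_mul (pow_le_pow_left₀ hpos'.le hle k) this (norm_nonneg _)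
          (pow_nonneg (hpos'.le.trans hle) k)
    _ = c := by
      rw [Real.rpow_neg (hpos'.le.trans hle), Real.rpow_natCast]
      have : euclNorm d (t • η) ≠ 0 := (hpos'.trans_le hle).ne'
      field_simp

end Mikhlin

section DifferencedMultiplier

variable {d : ℕ}

/-- The function `e^{-2πi ξ_i} - 1`, which turns a multiplier into the multiplier whose Fourier
coefficients are the differences in direction `i` of those of the original one. -/
noncomputable def shiftSymbol (i : Fin d) (ξ : Fin d → ℝ) : ℂ :=
  Complex.exp (-(2 * Real.pi * Complex.I) * (ξ i : ℂ)) - 1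

lemma shiftSymbol_periodic (i : Fin d) (ξ : Fin d → ℝ) (n : Fin d → ℤ) :
    shiftSymbol i (ξ + fun i => (n i : ℝ)) = shiftSymbol i ξ := by
  unfold shiftSymbol
  congr 1
  refine Complex.exp_eq_exp_iff_exists_int.2 ⟨-n i, ?_⟩
  simp
  ring

lemma contDiff_shiftSymbol (i : Fin d) {N : ℕ} : ContDiff ℝ N (shiftSymbol i) := by
  unfold shiftSymbol
  refine ContDiff.sub (ContDiff.cexp (contDiff_const.mul ?_)) contDiff_const
  exact Complex.ofRealCLM.contDiff.comp (contDiff_apply ℝ ℝ i)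

lemma norm_shiftSymbol_le (i : Fin d) (ξ : Fin d → ℝ) :
    ‖shiftSymbol i ξ‖ ≤ 2 * π * latticeDist ξ := by
  have h1 : shiftSymbol i ξ = shiftSymbol i fun i => ξ i - round (ξ i) := by
    rw [← shiftSymbol_periodic i (fun i => ξ i - round (ξ i)) fun i => round (ξ i)]
    congr 1
    funext i
    simp
  have h2 : ∀ x : Fin d → ℝ, shiftSymbol i x
      = Complex.exp (Complex.I * ((-(2 * π * x i) : ℝ) : ℂ)) - 1 := fun x => by
    unfold shiftSymbol
    congr 2
    push_cast
    ring
  rw [h1, h2]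
  refine Real.norm_exp_I_mul_ofReal_sub_one_le.trans ?_
  rw [norm_neg, norm_mul, Real.norm_of_nonneg (by positivity)]
  exact mul_le_mul_of_nonneg_left (abs_sub_round_le_latticeDist ξ i) (by positivity)

lemma exists_latticeDist_pow_mul_norm_iteratedFDeriv_mul_shiftSymbol_le {m : (Fin d → ℝ) → ℂ}
    {c : ℝ} (hsmooth : ContDiffOn ℝ (d + 1 : ℕ) m (latticeComp d))
    (hm : ∀ k ≤ d + 1, ∀ ξ ∈ latticeComp d, latticeDist ξ ^ k * ‖iteratedFDeriv ℝ k m ξ‖ ≤ c)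
    (i : Fin d) :
    ∃ C : ℝ, ∀ ξ ∈ latticeComp d,
      latticeDist ξ ^ d * ‖iteratedFDeriv ℝ (d + 1) (fun ξ => m ξ * shiftSymbol i ξ) ξ‖ ≤ C := by
  obtain ⟨U, hU0, hU⟩ := exists_norm_iteratedFDeriv_le_of_periodic (shiftSymbol_periodic i)
    (contDiff_shiftSymbol i (N := d + 1))
  refine ⟨∑ k ∈ Finset.range (d + 1 + 1), (d + 1).choose k * (c * (U + 2 * π)), fun ξ hξ => ?_⟩
  have hopen : ∀ (k : ℕ) (g : (Fin d → ℝ) → ℂ),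
      iteratedFDerivWithin ℝ k g (latticeComp d) ξ = iteratedFDeriv ℝ k g ξ := fun k g =>
    iteratedFDerivWithin_of_isOpen _ isOpen_latticeComp hξ
  have h1 := norm_iteratedFDerivWithin_mul_le hsmooth
    (contDiff_shiftSymbol i (N := d + 1)).contDiffOn isOpen_latticeComp.uniqueDiffOn hξ
    (n := d + 1) le_rfl
  simp only [hopen] at h1
  have hδ := (mem_latticeComp_iff ξ).1 hξ
  refine (mul_le_mul_of_nonneg_left h1 (by positivity)).trans ?_
  rw [Finset.mul_sum]
  refine Finset.sum_le_sum fun k hk => ?_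
  have hk' : k ≤ d + 1 := Nat.lt_succ_iff.1 (Finset.mem_range.1 hk)
  have hmk := hm k hk' ξ hξ
  have hc : 0 ≤ c := le_trans (by positivity) hmk
  suffices latticeDist ξ ^ d * (‖iteratedFDeriv ℝ k m ξ‖ *
      ‖iteratedFDeriv ℝ (d + 1 - k) (shiftSymbol i) ξ‖) ≤ c * (U + 2 * π) by
    have h2 : (0 : ℝ) ≤ (d + 1).choose k := by positivity
    nlinarith
  rcases hk'.eq_or_lt with rfl | hlt
  · rw [Nat.sub_self, norm_iteratedFDeriv_zero]
    calc _ ≤ latticeDist ξ ^ d * (‖iteratedFDeriv ℝ (d + 1) m ξ‖ * (2 * π * latticeDist ξ)) := by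
          gcongr
          exact norm_shiftSymbol_le i ξ
      _ = (latticeDist ξ ^ (d + 1) * ‖iteratedFDeriv ℝ (d + 1) m ξ‖) * (2 * π) := by ring
      _ ≤ c * (U + 2 * π) := by gcongr; linarith
  · calc _ ≤ latticeDist ξ ^ k * (‖iteratedFDeriv ℝ k m ξ‖ * U) := by
          refine mul_le_mul (pow_le_pow_of_le_one hδ.le (latticeDist_le_one ξ)
            (Nat.lt_succ_iff.1 hlt)) ?_ (by positivity) (by positivity)
          gcongr
          exact hU _ (Nat.sub_le _ _) ξ
      _ = (latticeDist ξ ^ k * ‖iteratedFDeriv ℝ k m ξ‖) * U := by ring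
      _ ≤ c * (U + 2 * π) := by gcongr; linarith [Real.pi_pos]

lemma exists_norm_fwdDiff_iter_le {g : (Fin d → ℝ) → ℂ} {A B : ℝ}
    (hsmooth : ContDiffOn ℝ (d + 1 : ℕ) g (latticeComp d))
    (hA : ∀ ξ, ‖g ξ‖ ≤ A * latticeDist ξ)
    (hB : ∀ ξ ∈ latticeComp d, latticeDist ξ ^ d * ‖iteratedFDeriv ℝ (d + 1) g ξ‖ ≤ B) :
    ∃ C : ℝ, 0 ≤ C ∧ ∀ v : Fin d → ℝ, 0 < ‖v‖ → ∀ ξ,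
      ‖(fwdDiff v)^[d + 1] g ξ‖ ≤ C * ‖v‖ * (‖v‖ / (‖v‖ + latticeDist ξ)) ^ d := by
  set s : ℝ := d + 1 with hs
  have hs1 : 1 ≤ s := by rw [hs]; linarith [(Nat.cast_nonneg d : (0 : ℝ) ≤ d)]
  set C₁ : ℝ := 2 ^ (d + 1) * (3 * s * |A|) * (2 * s + 1) ^ d with hC₁
  set C₂ : ℝ := 4 ^ d * |B| with hC₂
  refine ⟨C₁ + C₂, by positivity, fun v hv ξ => ?_⟩
  set h := ‖v‖ with hh
  have hδ := latticeDist_nonneg ξ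
  set δ := latticeDist ξ with hδ'
  have hdist : ∀ t ∈ Set.Icc (0 : ℝ) s, δ ≤ latticeDist (ξ + t • v) + s * h ∧
      latticeDist (ξ + t • v) ≤ δ + s * h := fun t ht => by
    have h1 : ‖t • v‖ ≤ s * h := by
      rw [norm_smul, Real.norm_of_nonneg ht.1]
      exact mul_le_mul_of_nonneg_right ht.2 hv.le
    exact ⟨(latticeDist_le_add ξ (t • v)).trans (by gcongr),
      (latticeDist_add_le ξ (t • v)).trans (by gcongr)⟩
  have hratio : 0 ≤ h / (h + δ) := by positivity
  rcases le_or_gt δ (2 * s * h) with hle | hgt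
  · have h1 : ‖(fwdDiff v)^[d + 1] g ξ‖ ≤ 2 ^ (d + 1) * (3 * s * |A| * h) := by
      refine norm_fwdDiff_iter_le_of_norm_le (d + 1) fun k hk => ?_
      have hk' : (k : ℝ) ≤ s := by rw [hs]; exact_mod_cast hk
      have h2 := (hdist k ⟨Nat.cast_nonneg k, hk'⟩).2
      rw [Nat.cast_smul_eq_nsmul] at h2
      refine (hA _).trans ?_
      calc _ ≤ |A| * latticeDist (ξ + k • v) :=
            mul_le_mul_of_nonneg_right (le_abs_self A) (latticeDist_nonneg _)
        _ ≤ |A| * (3 * s * h) := by gcongr; linarith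
        _ = _ := by ring
    have h3 : 1 ≤ (2 * s + 1) ^ d * (h / (h + δ)) ^ d := by
      rw [← mul_pow]
      refine one_le_pow₀ ?_
      rw [← mul_div_assoc, le_div_iff₀ (by positivity)]
      linarith
    calc _ ≤ 2 ^ (d + 1) * (3 * s * |A| * h) * 1 := by rwa [mul_one]
      _ ≤ 2 ^ (d + 1) * (3 * s * |A| * h) * ((2 * s + 1) ^ d * (h / (h + δ)) ^ d) := by gcongr
      _ = C₁ * h * (h / (h + δ)) ^ d := by rw [hC₁]; ring
      _ ≤ _ := by
        gcongr
        exact le_add_of_nonneg_right (by positivity)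
  · have hsh : h ≤ s * h := le_mul_of_one_le_left hv.le hs1
    have hδ0 : 0 < δ := by linarith
    have hhalf : ∀ t ∈ Set.Icc (0 : ℝ) s, δ / 2 ≤ latticeDist (ξ + t • v) := fun t ht => by
      linarith [(hdist t ht).1]
    have hmem : ∀ t ∈ Set.Icc (0 : ℝ) s, ξ + t • v ∈ latticeComp d := fun t ht =>
      (mem_latticeComp_iff _).2 (by linarith [hhalf t ht])
    have hcast : ((d + 1 : ℕ) : ℝ) = s := by rw [hs]; push_cast; rfl
    have h1 : ‖(fwdDiff v)^[d + 1] g ξ‖ ≤ |B| * (2 / δ) ^ d * h ^ (d + 1) := by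
      refine norm_fwdDiff_iter_le_of_norm_iteratedFDeriv_le (d + 1) (fun t ht => ?_)
        (fun t ht => ?_)
      · rw [hcast] at ht
        exact hsmooth.contDiffAt (isOpen_latticeComp.mem_nhds (hmem t ht))
      · rw [hcast] at ht
        have h2 := hB _ (hmem t ht)
        have h3 : (δ / 2) ^ d * ‖iteratedFDeriv ℝ (d + 1) g (ξ + t • v)‖ ≤ |B| := by
          refine le_trans ?_ (h2.trans (le_abs_self B))
          gcongr
          exact hhalf t ht
        rw [div_pow, ← mul_div_assoc, le_div_iff₀ (by positivity)]
        rw [div_pow, div_mul_eq_mul_div, div_le_iff₀ (by positivity)] at h3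
        linarith
    calc _ ≤ _ := h1
      _ = |B| * h * (2 * h / δ) ^ d := by rw [div_pow, div_pow, mul_pow]; ring
      _ ≤ |B| * h * (4 * (h / (h + δ))) ^ d := by
        gcongr
        rw [← mul_div_assoc, div_le_div_iff₀ hδ0 (by positivity)]
        nlinarith
      _ = C₂ * h * (h / (h + δ)) ^ d := by rw [hC₂, mul_pow]; ring
      _ ≤ _ := by
        gcongr
        exact le_add_of_nonneg_left (by positivity)

end DifferencedMultiplier

section IntegralBound

variable {d : ℕ}

lemma integral_sq_div_add_le {h : ℝ} (hh : 0 < h) :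
    ∫ t in Set.Ioo (0 : ℝ) 1, ((h / (h + t)) ^ 2 + (h / (h + (1 - t))) ^ 2) ≤ 2 * h := by
  have hderiv : ∀ t ∈ Set.uIcc (0 : ℝ) 1,
      HasDerivAt (fun t => -(h ^ 2 / (h + t)) + h ^ 2 / (h + (1 - t)))
        ((h / (h + t)) ^ 2 + (h / (h + (1 - t))) ^ 2) t := by
    intro t ht
    rw [Set.uIcc_of_le zero_le_one] at ht
    have h1 : h + t ≠ 0 := by linarith [ht.1]
    have h2 : h + (1 - t) ≠ 0 := by linarith [ht.2]
    have h3 : HasDerivAt (fun t => h + t) 1 t := (hasDerivAt_id t).const_add h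
    have h4 : HasDerivAt (fun t => h + (1 - t)) (-1) t :=
      ((hasDerivAt_id t).const_sub 1).const_add h
    refine (((hasDerivAt_const t (h ^ 2)).fun_div h3 h1).fun_neg.fun_add
      ((hasDerivAt_const t (h ^ 2)).fun_div h4 h2)).congr_deriv ?_
    field_simp
    ring
  have hcont : ContinuousOn (fun t => (h / (h + t)) ^ 2 + (h / (h + (1 - t))) ^ 2)
      (Set.uIcc (0 : ℝ) 1) := by
    rw [Set.uIcc_of_le zero_le_one]
    refine ContinuousOn.add (ContinuousOn.pow (ContinuousOn.div (by fun_prop) (by fun_prop) ?_) 2)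
      (ContinuousOn.pow (ContinuousOn.div (by fun_prop) (by fun_prop) ?_) 2)
    · intro t ht; linarith [ht.1]
    · intro t ht; linarith [ht.2]
  have := intervalIntegral.integral_eq_sub_of_hasDerivAt hderiv hcont.intervalIntegrable
  rw [← integral_Ioc_eq_integral_Ioo, ← intervalIntegral.integral_of_le zero_le_one, this]
  have h5 : 0 ≤ h ^ 2 / (h + 1) := by positivity
  have h6 : h ^ 2 / h = h := by field_simp
  simp only [sub_self, add_zero, sub_zero, h6]
  linarith

lemma lintegral_unitCube_enorm_sq_le {G : (Fin d → ℝ) → ℂ} {D h : ℝ} (hh : 0 < h)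
    (hG : ∀ ξ, ‖G ξ‖ ≤ D * (h / (h + latticeDist ξ)) ^ d) :
    ∫⁻ ξ in unitCube d, ‖G ξ‖ₑ ^ 2 ≤ ENNReal.ofReal (D ^ 2 * (2 * h) ^ d) := by
  set φ : ℝ → ℝ := fun t => (h / (h + t)) ^ 2 + (h / (h + (1 - t))) ^ 2 with hφ
  have hφ0 : ∀ t, 0 ≤ φ t := fun t => by positivity
  have hmeas : MeasurableSet (unitCube d) := MeasurableSet.univ_pi fun _ => measurableSet_Ioo
  have hrestr : (volume : Measure (Fin d → ℝ)).restrict (unitCube d)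
      = Measure.pi fun _ => (volume : Measure ℝ).restrict (Set.Ioo 0 1) := by
    rw [unitCube, volume_pi, Measure.restrict_pi_pi]
  have hφint : Integrable φ ((volume : Measure ℝ).restrict (Set.Ioo 0 1)) := by
    have hcont : ContinuousOn φ (Set.Icc 0 1) := by
      refine ContinuousOn.add
        (ContinuousOn.pow (ContinuousOn.div (by fun_prop) (by fun_prop) ?_) 2)
        (ContinuousOn.pow (ContinuousOn.div (by fun_prop) (by fun_prop) ?_) 2)
      · intro t ht; linarith [ht.1]
      · intro t ht; linarith [ht.2]
    exact hcont.integrableOn_Icc.mono_set Set.Ioo_subset_Icc_self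
  have hpoint : ∀ ξ ∈ unitCube d,
      ‖G ξ‖ₑ ^ 2 ≤ ENNReal.ofReal (D ^ 2 * ∏ i, φ (ξ i)) := by
    intro ξ hξ
    rw [← ofReal_norm, ← ENNReal.ofReal_pow (norm_nonneg _)]
    refine ENNReal.ofReal_le_ofReal ?_
    have hδ := latticeDist_nonneg ξ
    calc ‖G ξ‖ ^ 2 ≤ (D * (h / (h + latticeDist ξ)) ^ d) ^ 2 := by gcongr; exact hG ξ
      _ = D ^ 2 * ∏ _i : Fin d, (h / (h + latticeDist ξ)) ^ 2 := by
        rw [Finset.prod_const, Finset.card_univ, Fintype.card_fin]; ring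
      _ ≤ D ^ 2 * ∏ i, φ (ξ i) := by
        refine mul_le_mul_of_nonneg_left (Finset.prod_le_prod (fun _ _ => by positivity)
          fun i _ => ?_) (sq_nonneg D)
        have hi : 0 < ξ i ∧ ξ i < 1 := hξ i trivial
        have h1 := abs_sub_round_le_latticeDist ξ i
        rw [abs_sub_round_eq_min, Int.fract_eq_self.2 ⟨hi.1.le, hi.2⟩] at h1
        have key : ∀ t, 0 < t → t ≤ latticeDist ξ →
            (h / (h + latticeDist ξ)) ^ 2 ≤ (h / (h + t)) ^ 2 := fun t ht htle => by gcongr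
        rcases min_le_iff.1 h1 with h2 | h2
        · exact (key _ hi.1 h2).trans (le_add_of_nonneg_right (sq_nonneg _))
        · exact (key _ (by linarith [hi.2]) h2).trans (le_add_of_nonneg_left (sq_nonneg _))
  refine (setLIntegral_mono' hmeas hpoint).trans ?_
  rw [hrestr, ← ofReal_integral_eq_lintegral_ofReal
    ((Integrable.fintype_prod fun _ => hφint).const_mul _)
    (.of_forall fun ξ => mul_nonneg (sq_nonneg D) (Finset.prod_nonneg fun i _ => hφ0 _)),
    integral_const_mul, integral_fintype_prod_eq_pow, Fintype.card_fin]
  refine ENNReal.ofReal_le_ofReal ?_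
  gcongr
  exact integral_sq_div_add_le hh

end IntegralBound

section TorusLift

variable {d : ℕ}

noncomputable local instance : MeasureSpace UnitAddCircle := ⟨AddCircle.haarAddCircle⟩

local instance : Measure.IsAddHaarMeasure (volume : Measure UnitAddCircle) :=
  inferInstanceAs (Measure.IsAddHaarMeasure AddCircle.haarAddCircle)

local instance : IsProbabilityMeasure (volume : Measure UnitAddCircle) :=
  inferInstanceAs (IsProbabilityMeasure AddCircle.haarAddCircle)

/-- Invariance under translations by the integer lattice. -/
def LatticePeriodic {X : Type*} (F : (Fin d → ℝ) → X) : Prop :=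
  ∀ (ξ : Fin d → ℝ) (n : Fin d → ℤ), F (ξ + fun i => (n i : ℝ)) = F ξ

/-- The function on the torus induced by a periodic function on `ℝ^d`. -/
noncomputable def torusLift {X : Type*} (F : (Fin d → ℝ) → X) (x : UnitAddTorus (Fin d)) : X :=
  F fun i => (AddCircle.equivIoc 1 0 (x i)).1

lemma torusLift_coe {X : Type*} {F : (Fin d → ℝ) → X} (hF : LatticePeriodic F) (ξ : Fin d → ℝ) :
    torusLift F (fun i => (ξ i : UnitAddCircle)) = F ξ := by
  rw [← hF _ fun i => -toIocDiv (zero_lt_one' ℝ) 0 (ξ i)]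
  unfold torusLift
  congr 1
  funext i
  change toIocMod (zero_lt_one' ℝ) 0 (ξ i) = _
  have := toIocMod_add_toIocDiv_zsmul (zero_lt_one' ℝ) 0 (ξ i)
  rw [zsmul_one] at this
  simp only [Pi.add_apply, Int.cast_neg]
  linarith

lemma measurable_torusLift {F : (Fin d → ℝ) → ℂ} (hF : Measurable F) :
    Measurable (torusLift F) :=
  hF.comp (measurable_pi_lambda _ fun i => measurable_subtype_coe.comp
    ((AddCircle.measurableEquivIoc 1 0).measurable.comp (measurable_pi_apply i)))

lemma unitCube_ae_eq : (unitCube d : Set (Fin d → ℝ)) =ᵐ[volume]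
    {x : Fin d → ℝ | ∀ i, x i ∈ Set.Ioc ((0 : Fin d → ℝ) i) ((0 : Fin d → ℝ) i + 1)} := by
  have h1 : {x : Fin d → ℝ | ∀ i, x i ∈ Set.Ioc ((0 : Fin d → ℝ) i) ((0 : Fin d → ℝ) i + 1)}
      = Set.univ.pi fun _ => Set.Ioc (0 : ℝ) 1 := by
    ext x
    simp
  rw [h1, unitCube, volume_pi]
  exact (Measure.univ_pi_Ioo_ae_eq_Icc (f := fun _ : Fin d => (0 : ℝ)) (g := fun _ => 1)).trans
    (Measure.univ_pi_Ioc_ae_eq_Icc (f := fun _ : Fin d => (0 : ℝ)) (g := fun _ => 1)).symm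

lemma lintegral_torusLift {F : (Fin d → ℝ) → ℝ≥0∞} (hF : LatticePeriodic F) :
    ∫⁻ x, torusLift F x = ∫⁻ ξ in unitCube d, F ξ := by
  rw [UnitAddTorus.lintegral_preimage _ 0, setLIntegral_congr unitCube_ae_eq]
  exact lintegral_congr fun ξ => torusLift_coe hF ξ

lemma integral_torusLift {F : (Fin d → ℝ) → ℂ} (hF : LatticePeriodic F) :
    ∫ x, torusLift F x = ∫ ξ in unitCube d, F ξ := by
  rw [UnitAddTorus.integral_preimage _ 0, setIntegral_congr_set unitCube_ae_eq]
  exact integral_congr_ae (.of_forall fun ξ => torusLift_coe hF ξ)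

lemma setIntegral_unitCube_comp_add {F : (Fin d → ℝ) → ℂ} (hF : LatticePeriodic F)
    (v : Fin d → ℝ) : ∫ ξ in unitCube d, F (ξ + v) = ∫ ξ in unitCube d, F ξ := by
  have hF' : LatticePeriodic fun ξ => F (ξ + v) := fun ξ n => by
    simp only [add_right_comm ξ _ v]
    exact hF _ n
  rw [← integral_torusLift hF, ← integral_torusLift hF']
  have h1 : ∀ x, torusLift (fun ξ => F (ξ + v)) x
      = torusLift F (x + fun i => (v i : UnitAddCircle)) := by
    intro x
    have h2 : x = fun i => (((AddCircle.equivIoc 1 0 (x i)).1 : ℝ) : UnitAddCircle) :=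
      funext fun i => ((AddCircle.equivIoc 1 0).symm_apply_apply (x i)).symm
    set ξ : Fin d → ℝ := fun i => (AddCircle.equivIoc 1 0 (x i)).1 with hξ
    have h3 : x + (fun i => (v i : UnitAddCircle)) = fun i => (((ξ + v) i : ℝ) : UnitAddCircle) := by
      rw [h2]
      funext i
      simp [hξ]
    rw [h3, torusLift_coe hF]
    rfl
  simp_rw [h1]
  exact integral_add_right_eq_self (torusLift F) _

/-- The character `ξ ↦ e^{2πi n·ξ}`. -/
noncomputable def latticeChar (n : Fin d → ℤ) (ξ : Fin d → ℝ) : ℂ :=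
  Complex.exp (2 * Real.pi * Complex.I * ∑ i, (n i : ℂ) * (ξ i : ℂ))

/-- Fourier coefficients of a periodic function on `ℝ^d`. -/
noncomputable def latticeCoeff (F : (Fin d → ℝ) → ℂ) (n : Fin d → ℤ) : ℂ :=
  ∫ ξ in unitCube d, F ξ * latticeChar (-n) ξ

lemma latticeChar_add_left (n k : Fin d → ℤ) (ξ : Fin d → ℝ) :
    latticeChar (n + k) ξ = latticeChar n ξ * latticeChar k ξ := by
  unfold latticeChar
  rw [← Complex.exp_add]
  congr 1
  rw [← mul_add, ← Finset.sum_add_distrib]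
  congr 1
  refine Finset.sum_congr rfl fun i _ => ?_
  simp
  ring

lemma latticeChar_add_right (n : Fin d → ℤ) (ξ v : Fin d → ℝ) :
    latticeChar n (ξ + v) = latticeChar n ξ * latticeChar n v := by
  unfold latticeChar
  rw [← Complex.exp_add]
  congr 1
  rw [← mul_add, ← Finset.sum_add_distrib]
  congr 1
  refine Finset.sum_congr rfl fun i _ => ?_
  simp
  ring

lemma latticeChar_neg_mul_self (n : Fin d → ℤ) (ξ : Fin d → ℝ) :
    latticeChar n ξ * latticeChar (-n) ξ = 1 := by
  rw [← latticeChar_add_left, add_neg_cancel]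
  simp [latticeChar]

lemma latticeChar_eq_exp_ofReal_mul_I (n : Fin d → ℤ) (ξ : Fin d → ℝ) :
    latticeChar n ξ = Complex.exp ((2 * π * ∑ i, (n i : ℝ) * ξ i : ℝ) * Complex.I) := by
  unfold latticeChar
  congr 1
  push_cast
  ring

lemma norm_latticeChar (n : Fin d → ℤ) (ξ : Fin d → ℝ) : ‖latticeChar n ξ‖ = 1 := by
  rw [latticeChar_eq_exp_ofReal_mul_I, Complex.norm_exp_ofReal_mul_I]

lemma continuous_latticeChar (n : Fin d → ℤ) : Continuous (latticeChar n) := by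
  unfold latticeChar
  fun_prop

lemma latticePeriodic_latticeChar (n : Fin d → ℤ) : LatticePeriodic (latticeChar n) := by
  intro ξ k
  rw [latticeChar_add_right]
  have : latticeChar n (fun i => (k i : ℝ)) = 1 := by
    refine Complex.exp_eq_one_iff.2 ⟨∑ i, n i * k i, ?_⟩
    push_cast
    ring
  rw [this, mul_one]

lemma mFourier_coe (n : Fin d → ℤ) (ξ : Fin d → ℝ) :
    UnitAddTorus.mFourier n (fun i => (ξ i : UnitAddCircle)) = latticeChar n ξ := by
  unfold latticeChar UnitAddTorus.mFourier
  simp only [ContinuousMap.coe_mk, fourier_coe_apply]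
  rw [← Complex.exp_sum, Finset.mul_sum]
  congr 1
  refine Finset.sum_congr rfl fun i _ => ?_
  push_cast
  ring

lemma mFourierCoeff_torusLift {F : (Fin d → ℝ) → ℂ} (hF : LatticePeriodic F) (n : Fin d → ℤ) :
    UnitAddTorus.mFourierCoeff (torusLift F) n = latticeCoeff F n := by
  rw [UnitAddTorus.mFourierCoeff_eq_integral _ _ 0, latticeCoeff,
    setIntegral_congr_set unitCube_ae_eq]
  refine integral_congr_ae (.of_forall fun ξ => ?_)
  simp only [torusLift_coe hF, mFourier_coe, smul_eq_mul]
  ring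

lemma tsum_enorm_latticeCoeff_sq {F : (Fin d → ℝ) → ℂ} (hF : LatticePeriodic F)
    (hmeas : Measurable F) {M : ℝ} (hM : ∀ ξ, ‖F ξ‖ ≤ M) :
    ∑' n, ‖latticeCoeff F n‖ₑ ^ 2 = ∫⁻ ξ in unitCube d, ‖F ξ‖ₑ ^ 2 := by
  have hLp : MemLp (torusLift F) 2 volume :=
    MemLp.of_bound (measurable_torusLift hmeas).aestronglyMeasurable M
      (.of_forall fun x => hM _)
  have h1 := UnitAddTorus.hasSum_sq_mFourierCoeff (hLp.toLp _)
  have h2 : ∀ n, UnitAddTorus.mFourierCoeff (hLp.toLp _) n = latticeCoeff F n := fun n => by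
    rw [← mFourierCoeff_torusLift hF]
    refine integral_congr_ae ?_
    filter_upwards [hLp.coeFn_toLp] with x hx
    rw [hx]
  simp_rw [h2] at h1
  have h3 : ∫ x, ‖hLp.toLp _ x‖ ^ 2 = ∫ x, ‖torusLift F x‖ ^ 2 := by
    refine integral_congr_ae ?_
    filter_upwards [hLp.coeFn_toLp] with x hx
    rw [hx]
  rw [h3] at h1
  have hsq : ∀ z : ℂ, ‖z‖ₑ ^ 2 = ENNReal.ofReal (‖z‖ ^ 2) := fun z => by
    rw [ENNReal.ofReal_pow (norm_nonneg _), ofReal_norm]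
  have h4 : LatticePeriodic fun ξ => ‖F ξ‖ₑ ^ 2 := fun ξ n => by simp only [hF ξ n]
  rw [← lintegral_torusLift h4]
  simp_rw [torusLift, hsq]
  rw [← ENNReal.ofReal_tsum_of_nonneg (fun _ => sq_nonneg _) h1.summable, h1.tsum_eq,
    ofReal_integral_eq_lintegral_ofReal (hLp.integrable_norm_pow (p := 2) two_ne_zero) (.of_forall fun x => sq_nonneg _)]
  rfl

end TorusLift

section Multiplier

variable {d : ℕ}

lemma measurable_of_continuousOn_latticeComp {F : (Fin d → ℝ) → ℂ}
    (hF : ContinuousOn F (latticeComp d)) : Measurable F := by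
  have hcount : (latticeComp d)ᶜ.Countable := by
    have : (latticeComp d)ᶜ = Set.range fun (n : Fin d → ℤ) i => (n i : ℝ) := by
      ext ξ
      simp [latticeComp, eq_comm]
    rw [this]
    exact Set.countable_range _
  refine measurable_of_restrict_of_restrict_compl isOpen_latticeComp.measurableSet
    (continuousOn_iff_continuous_domRestrict.1 hF).measurable ?_
  have := hcount.to_subtype
  exact measurable_of_countable _

lemma volume_unitCube : volume (unitCube d) = 1 := by
  rw [unitCube, volume_pi, Measure.pi_pi]
  simp

lemma integrableOn_unitCube {F : (Fin d → ℝ) → ℂ} (hmeas : Measurable F) {M : ℝ}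
    (hM : ∀ ξ, ‖F ξ‖ ≤ M) : IntegrableOn F (unitCube d) :=
  Measure.integrableOn_of_bounded (M := M) (by simp [volume_unitCube])
    hmeas.aestronglyMeasurable (.of_forall hM)

lemma measurable_mul_latticeChar {F : (Fin d → ℝ) → ℂ} (hmeas : Measurable F) (n : Fin d → ℤ) :
    Measurable fun ξ => F ξ * latticeChar n ξ :=
  hmeas.mul (continuous_latticeChar n).measurable

lemma integrableOn_mul_latticeChar {F : (Fin d → ℝ) → ℂ} (hmeas : Measurable F) {M : ℝ}
    (hM : ∀ ξ, ‖F ξ‖ ≤ M) (n : Fin d → ℤ) :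
    IntegrableOn (fun ξ => F ξ * latticeChar n ξ) (unitCube d) :=
  integrableOn_unitCube (measurable_mul_latticeChar hmeas n) (M := M) fun ξ => by
    rw [norm_mul, norm_latticeChar, mul_one]
    exact hM ξ

lemma norm_latticeCoeff_le {F : (Fin d → ℝ) → ℂ} {M : ℝ} (hM : ∀ ξ, ‖F ξ‖ ≤ M)
    (n : Fin d → ℤ) : ‖latticeCoeff F n‖ ≤ M := by
  have h1 := norm_setIntegral_le_of_norm_le_const (μ := volume) (s := unitCube d)
    (f := fun ξ => F ξ * latticeChar (-n) ξ) (C := M) (by simp [volume_unitCube])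
    fun ξ _ => by rw [norm_mul, norm_latticeChar, mul_one]; exact hM ξ
  rwa [measureReal_def, volume_unitCube, ENNReal.toReal_one, mul_one] at h1

lemma latticeCoeff_comp_add {F : (Fin d → ℝ) → ℂ} (hF : LatticePeriodic F) (v : Fin d → ℝ)
    (n : Fin d → ℤ) :
    latticeCoeff (fun ξ => F (ξ + v)) n = latticeChar n v * latticeCoeff F n := by
  have h1 : LatticePeriodic fun ξ => F ξ * latticeChar (-n) ξ := fun ξ k => by
    simp only [hF ξ k, latticePeriodic_latticeChar (-n) ξ k]
  rw [latticeCoeff, latticeCoeff, ← setIntegral_unitCube_comp_add h1 v, ← integral_const_mul]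
  congr 1
  funext ξ
  rw [latticeChar_add_right]
  linear_combination (-F (ξ + v) * latticeChar (-n) ξ) * latticeChar_neg_mul_self n v

lemma latticeCoeff_fwdDiff_iter {F : (Fin d → ℝ) → ℂ} (hF : LatticePeriodic F)
    (hmeas : Measurable F) {M : ℝ} (hM : ∀ ξ, ‖F ξ‖ ≤ M) (v : Fin d → ℝ) (n : Fin d → ℤ) (s : ℕ) :
    LatticePeriodic ((fwdDiff v)^[s] F) ∧ Measurable ((fwdDiff v)^[s] F) ∧
      (∀ ξ, ‖(fwdDiff v)^[s] F ξ‖ ≤ 2 ^ s * M) ∧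
      latticeCoeff ((fwdDiff v)^[s] F) n = (latticeChar n v - 1) ^ s * latticeCoeff F n := by
  induction s with
  | zero => exact ⟨hF, hmeas, fun ξ => by simpa using hM ξ, by simp⟩
  | succ s ih =>
    obtain ⟨h1, h2, h3, h4⟩ := ih
    rw [Function.iterate_succ_apply']
    set G := (fwdDiff v)^[s] F
    have h5 : fwdDiff v G = fun ξ => G (ξ + v) - G ξ := rfl
    have hGv : Measurable fun ξ => G (ξ + v) := h2.comp (measurable_add_const v)
    rw [h5]
    refine ⟨fun ξ k => ?_, hGv.sub h2, fun ξ => ?_, ?_⟩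
    · simp only [h1 ξ k, add_right_comm ξ _ v, h1 (ξ + v) k]
    · refine (norm_sub_le _ _).trans ((add_le_add (h3 _) (h3 _)).trans (le_of_eq ?_))
      ring
    · have h6 : latticeCoeff (fun ξ => G (ξ + v) - G ξ) n
          = latticeCoeff (fun ξ => G (ξ + v)) n - latticeCoeff G n := by
        unfold latticeCoeff
        rw [← integral_sub (integrableOn_mul_latticeChar hGv (fun ξ => h3 _) _)
          (integrableOn_mul_latticeChar h2 h3 _)]
        congr 1
        funext ξ
        ring
      rw [h6, latticeCoeff_comp_add h1, h4]
      ring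

lemma latticeCoeff_one [DecidableEq (Fin d → ℤ)] (n : Fin d → ℤ) :
    latticeCoeff (fun _ => 1) n = if n = 0 then 1 else 0 := by
  split_ifs with h
  · subst h
    simp [latticeCoeff, latticeChar, measureReal_def, volume_unitCube]
  · obtain ⟨i, hi⟩ := Function.ne_iff.1 h
    have h1 := latticeCoeff_comp_add (F := fun _ => 1) (fun _ _ => rfl)
      (Pi.single i (1 / (2 * (n i : ℝ)))) n
    have h2 : latticeChar n (Pi.single i (1 / (2 * (n i : ℝ)))) = -1 := by
      have hi' : (n i : ℝ) ≠ 0 := by exact_mod_cast hi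
      have h3 : ∑ j, (n j : ℝ) * (Pi.single i (1 / (2 * (n i : ℝ))) : Fin d → ℝ) j = 1 / 2 := by
        rw [Finset.sum_eq_single i]
        · rw [Pi.single_eq_same]
          field_simp
        · intro j _ hj
          rw [Pi.single_eq_of_ne hj, mul_zero]
        · simp
      rw [latticeChar_eq_exp_ofReal_mul_I, h3, ← Complex.exp_pi_mul_I]
      congr 2
      push_cast
      ring
    rw [h2] at h1
    simp only [neg_mul, one_mul] at h1
    linear_combination (1 / 2 : ℂ) * h1

lemma hasSum_dft {f : (Fin d → ℤ) → ℂ} (hf : Summable fun n => ‖f n‖) (ξ : Fin d → ℝ) :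
    HasSum (fun n => f n * latticeChar n ξ) (dft d f ξ) := by
  refine Summable.hasSum (Summable.of_norm ?_)
  simpa only [norm_mul, norm_latticeChar, mul_one] using hf

lemma continuous_dft {f : (Fin d → ℤ) → ℂ} (hf : Summable fun n => ‖f n‖) :
    Continuous (dft d f) := by
  refine continuous_tsum (u := fun n => ‖f n‖)
    (fun n => continuous_const.mul (continuous_latticeChar n)) hf fun n ξ => ?_
  exact (norm_mul_le _ _).trans (by rw [← latticeChar, norm_latticeChar, mul_one])

lemma norm_dft_le {f : (Fin d → ℤ) → ℂ} (hf : Summable fun n => ‖f n‖) (ξ : Fin d → ℝ) :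
    ‖dft d f ξ‖ ≤ ∑' n, ‖f n‖ := by
  refine tsum_of_norm_bounded hf.hasSum fun n => ?_
  exact (norm_mul_le _ _).trans (by rw [← latticeChar, norm_latticeChar, mul_one])

lemma latticePeriodic_dft (f : (Fin d → ℤ) → ℂ) : LatticePeriodic (dft d f) := by
  intro ξ n
  have : ∀ ξ, dft d f ξ = ∑' k, f k * latticeChar k ξ := fun _ => rfl
  rw [this, this]
  simp only [latticePeriodic_latticeChar _ ξ n]

lemma Tmult_eq_latticeCoeff (m : (Fin d → ℝ) → ℂ) (f : (Fin d → ℤ) → ℂ) (n : Fin d → ℤ) :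
    Tmult d m f n = latticeCoeff (fun ξ => m ξ * dft d f ξ) n := by
  unfold Tmult latticeCoeff latticeChar
  congr 1
  funext ξ
  congr 2
  rw [Finset.mul_sum, Finset.mul_sum]
  refine Finset.sum_congr rfl fun i _ => ?_
  simp
  ring

lemma Tmult_eq_latticeConv {m : (Fin d → ℝ) → ℂ} (hmeas : Measurable m) {M : ℝ}
    (hM : ∀ ξ, ‖m ξ‖ ≤ M) {f : (Fin d → ℤ) → ℂ} (hf : Summable fun n => ‖f n‖) :
    Tmult d m f = latticeConv (latticeCoeff m) f := by
  funext n
  rw [Tmult_eq_latticeCoeff, latticeConv, latticeCoeff]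
  have hM0 : 0 ≤ M := (norm_nonneg _).trans (hM 0)
  have hint : ∀ k, IntegrableOn (fun ξ => f k * (m ξ * latticeChar (-(n - k)) ξ)) (unitCube d) :=
    fun k => (integrableOn_mul_latticeChar hmeas hM _).const_mul _
  have hsum : Summable fun k => ∫ ξ in unitCube d, ‖f k * (m ξ * latticeChar (-(n - k)) ξ)‖ := by
    refine Summable.of_nonneg_of_le (fun k => integral_nonneg fun ξ => norm_nonneg _)
      (fun k => ?_) (hf.mul_right M)
    have h1 := norm_setIntegral_le_of_norm_le_const (μ := volume) (s := unitCube d)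
      (f := fun ξ => ‖f k * (m ξ * latticeChar (-(n - k)) ξ)‖) (C := ‖f k‖ * M)
      (by simp [volume_unitCube])
      fun ξ _ => by
        rw [norm_norm, norm_mul, norm_mul, norm_latticeChar, mul_one]
        exact mul_le_mul_of_nonneg_left (hM ξ) (norm_nonneg _)
    rw [measureReal_def, volume_unitCube, ENNReal.toReal_one, mul_one] at h1
    exact (le_abs_self _).trans h1
  have := integral_tsum_of_summable_integral_norm hint hsum
  simp only [integral_const_mul] at this
  simp only [latticeCoeff]
  rw [this]
  congr 1
  funext ξ
  rw [← (hasSum_dft hf ξ).tsum_eq, ← tsum_mul_left, ← tsum_mul_right]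
  refine tsum_congr fun k => ?_
  rw [neg_sub, sub_eq_add_neg, latticeChar_add_left]
  ring

lemma latticeCoeff_dft {f : (Fin d → ℤ) → ℂ} (hf : Summable fun n => ‖f n‖) (n : Fin d → ℤ) :
    latticeCoeff (dft d f) n = f n := by
  classical
  have h1 := Tmult_eq_latticeCoeff (fun _ => 1) f n
  simp only [one_mul] at h1
  rw [← h1, Tmult_eq_latticeConv measurable_const (M := 1) (fun _ => by simp) hf, latticeConv]
  rw [tsum_eq_single n fun k hk => ?_]
  · simp [latticeCoeff_one]
  · rw [latticeCoeff_one, if_neg (sub_ne_zero.2 hk.symm), mul_zero]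

lemma tsum_enorm_Tmult_sq_le {m : (Fin d → ℝ) → ℂ} (hper : LatticePeriodic m)
    (hmeas : Measurable m) {M : ℝ} (hM : ∀ ξ, ‖m ξ‖ ≤ M) {f : (Fin d → ℤ) → ℂ}
    (hf : Summable fun n => ‖f n‖) :
    ∑' n, ‖Tmult d m f n‖ₑ ^ 2 ≤ ENNReal.ofReal (M ^ 2) * ∑' n, ‖f n‖ₑ ^ 2 := by
  have hM0 : 0 ≤ M := (norm_nonneg _).trans (hM 0)
  have h1 := tsum_enorm_latticeCoeff_sq (latticePeriodic_dft f) (continuous_dft hf).measurable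
    (norm_dft_le hf)
  simp only [latticeCoeff_dft hf] at h1
  have h2 : LatticePeriodic fun ξ => m ξ * dft d f ξ := fun ξ k => by
    simp only [hper ξ k, latticePeriodic_dft f ξ k]
  have h3 := tsum_enorm_latticeCoeff_sq h2 (hmeas.mul (continuous_dft hf).measurable)
    (M := M * ∑' n, ‖f n‖) fun ξ => by
      rw [norm_mul]
      exact mul_le_mul (hM ξ) (norm_dft_le hf ξ) (norm_nonneg _) hM0
  simp only [Tmult_eq_latticeCoeff]
  rw [h3, h1, ← lintegral_const_mul' _ _ ENNReal.ofReal_ne_top]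
  refine lintegral_mono fun ξ => ?_
  rw [enorm_mul, mul_pow, ENNReal.ofReal_pow hM0]
  gcongr
  rw [← ofReal_norm]
  exact ENNReal.ofReal_le_ofReal (hM ξ)

end Multiplier

section Telescoping

variable {d : ℕ}

/-- The sum over `‖n‖ ≥ ρ` of the increments `|K (n + z) - K n|`. -/
noncomputable def tailIncrement (K : (Fin d → ℤ) → ℂ) (ρ : ℝ) (z : Fin d → ℤ) : ℝ≥0∞ :=
  ∑' n, {n : Fin d → ℤ | ρ ≤ ‖n‖}.indicator (fun n => ‖K (n + z) - K n‖ₑ) n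

variable (K : (Fin d → ℤ) → ℂ)

lemma tailIncrement_zero (ρ : ℝ) : tailIncrement K ρ 0 = 0 := by
  simp [tailIncrement]

lemma tsum_indicator_increment_le {ρ ρ' : ℝ} {z : Fin d → ℤ} (h : ρ' + ‖z‖ ≤ ρ) (w : Fin d → ℤ) :
    ∑' n, {n : Fin d → ℤ | ρ ≤ ‖n‖}.indicator (fun n => ‖K (n + z + w) - K (n + z)‖ₑ) n
      ≤ tailIncrement K ρ' w := by
  rw [tailIncrement, ← (Equiv.addRight z).tsum_eq
    ({n : Fin d → ℤ | ρ' ≤ ‖n‖}.indicator fun n => ‖K (n + w) - K n‖ₑ)]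
  refine ENNReal.tsum_le_tsum fun n => ?_
  by_cases hn : ρ ≤ ‖n‖
  · rw [Set.indicator_of_mem (show n ∈ {n : Fin d → ℤ | ρ ≤ ‖n‖} from hn),
      Set.indicator_of_mem]
    · rfl
    · change ρ' ≤ ‖n + z‖
      have := norm_sub_le (n + z) z
      rw [add_sub_cancel_right] at this
      linarith
  · rw [Set.indicator_of_notMem (show n ∉ {n : Fin d → ℤ | ρ ≤ ‖n‖} from hn)]
    exact zero_le

lemma tailIncrement_add_le {ρ ρ' : ℝ} {z : Fin d → ℤ} (h : ρ' + ‖z‖ ≤ ρ) (w : Fin d → ℤ) :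
    tailIncrement K ρ (z + w) ≤ tailIncrement K ρ z + tailIncrement K ρ' w := by
  refine le_trans ?_ (add_le_add le_rfl (tsum_indicator_increment_le K h w))
  rw [tailIncrement, tailIncrement, ← ENNReal.tsum_add]
  refine ENNReal.tsum_le_tsum fun n => ?_
  by_cases hn : n ∈ {n : Fin d → ℤ | ρ ≤ ‖n‖}
  swap
  · simp only [Set.indicator_of_notMem hn, zero_le]
  simp only [Set.indicator_of_mem hn]
  have : K (n + (z + w)) - K n = (K (n + z) - K n) + (K (n + z + w) - K (n + z)) := by
    rw [add_assoc]; ring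
  rw [this]
  exact enorm_add_le _ _

lemma tailIncrement_neg_le {ρ ρ' : ℝ} {z : Fin d → ℤ} (h : ρ' + ‖z‖ ≤ ρ) :
    tailIncrement K ρ (-z) ≤ tailIncrement K ρ' z := by
  rw [← norm_neg] at h
  refine le_trans (le_of_eq ?_) (tsum_indicator_increment_le K h z)
  rw [tailIncrement]
  refine tsum_congr fun n => ?_
  congr 1
  funext n
  rw [neg_add_cancel_right, ← enorm_neg, neg_sub]

lemma norm_nsmul_single (a : ℕ) (i : Fin d) : ‖a • (Pi.single i 1 : Fin d → ℤ)‖ = a := by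
  rw [← Pi.single_smul', Pi.norm_single]
  simp

lemma tailIncrement_nsmul_single_le {ρ r : ℝ} {i : Fin d} {B : ℝ≥0∞}
    (hB : tailIncrement K r (Pi.single i 1) ≤ B) (a : ℕ) (ha : r + a ≤ ρ) :
    tailIncrement K ρ (a • Pi.single i 1) ≤ a * B := by
  induction a with
  | zero => simp [tailIncrement_zero]
  | succ a ih =>
    push_cast at ha ⊢
    rw [succ_nsmul, add_mul, one_mul]
    refine (tailIncrement_add_le K (ρ' := r) ?_ _).trans (add_le_add (ih (by linarith)) hB)
    rw [norm_nsmul_single]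
    linarith

lemma tailIncrement_le {j : ℕ} {B : ℝ≥0∞}
    (hB : ∀ i, tailIncrement K (2 ^ j) (Pi.single i 1) ≤ B) {z : Fin d → ℤ} (hz : ‖z‖ ≤ 2 ^ j) :
    tailIncrement K (4 * 2 ^ j) z ≤ d * (2 ^ j * B) := by
  have hcoord : ∀ i, tailIncrement K (3 * 2 ^ j) (Pi.single i (z i)) ≤ 2 ^ j * B := by
    intro i
    have hzi : ((z i).natAbs : ℝ) ≤ 2 ^ j := by
      have := (norm_le_pi_norm z i).trans hz
      rwa [Int.norm_eq_abs, ← Int.cast_abs, Int.abs_eq_natAbs, Int.cast_natCast] at this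
    have hle : ((z i).natAbs : ℝ≥0∞) * B ≤ 2 ^ j * B := by
      gcongr
      exact_mod_cast hzi
    refine le_trans ?_ hle
    have hpos : (0 : ℝ) < 2 ^ j := by positivity
    rcases Int.natAbs_eq (z i) with h | h
    · have : (Pi.single i (z i) : Fin d → ℤ) = (z i).natAbs • Pi.single i 1 := by
        rw [← Pi.single_smul']
        congr 1
        simpa using h
      rw [this]
      exact tailIncrement_nsmul_single_le K (hB i) _ (by linarith)
    · have : (Pi.single i (z i) : Fin d → ℤ) = -((z i).natAbs • Pi.single i 1) := by
        rw [← Pi.single_smul', ← Pi.single_neg]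
        congr 1
        simpa using h
      rw [this]
      refine (tailIncrement_neg_le K (ρ' := 2 * 2 ^ j) ?_).trans
        (tailIncrement_nsmul_single_le K (hB i) _ (by linarith))
      rw [norm_nsmul_single]
      linarith
  have hsum : ∀ s : Finset (Fin d),
      tailIncrement K (4 * 2 ^ j) (∑ i ∈ s, Pi.single i (z i)) ≤ s.card * (2 ^ j * B) := by
    intro s
    induction s using Finset.induction_on with
    | empty => simp [tailIncrement_zero]
    | insert i s hi ih =>
      rw [Finset.sum_insert hi, add_comm, Finset.card_insert_of_notMem hi, Nat.cast_add_one,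
        add_mul, one_mul]
      refine (tailIncrement_add_le K (ρ' := 3 * 2 ^ j) ?_ _).trans (add_le_add ih (hcoord i))
      have : ‖∑ i ∈ s, (Pi.single i (z i) : Fin d → ℤ)‖ ≤ ‖z‖ := by
        refine (pi_norm_le_iff_of_nonneg (norm_nonneg _)).2 fun l => ?_
        rw [Finset.sum_apply]
        by_cases hl : l ∈ s
        · rw [Finset.sum_eq_single_of_mem l hl fun k _ hk => Pi.single_eq_of_ne hk.symm _,
            Pi.single_eq_same]
          exact norm_le_pi_norm z l
        · rw [Finset.sum_eq_zero fun k hk => Pi.single_eq_of_ne (by rintro rfl; exact hl hk) _,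
            norm_zero]
          exact norm_nonneg _
      linarith
  have := hsum Finset.univ
  rwa [Finset.univ_sum_single, Finset.card_univ, Fintype.card_fin] at this

end Telescoping

section DyadicBlocks

variable {d : ℕ}

lemma latticeCoeff_mul_shiftSymbol {m : (Fin d → ℝ) → ℂ} (hmeas : Measurable m) {M : ℝ}
    (hM : ∀ ξ, ‖m ξ‖ ≤ M) (i : Fin d) (n : Fin d → ℤ) :
    latticeCoeff (fun ξ => m ξ * shiftSymbol i ξ) n
      = latticeCoeff m (n + Pi.single i 1) - latticeCoeff m n := by
  unfold latticeCoeff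
  rw [← integral_sub (integrableOn_mul_latticeChar hmeas hM _)
    (integrableOn_mul_latticeChar hmeas hM _)]
  congr 1
  funext ξ
  have h1 : latticeChar (-Pi.single i 1) ξ = shiftSymbol i ξ + 1 := by
    rw [latticeChar, shiftSymbol, sub_add_cancel]
    congr 1
    rw [Finset.sum_eq_single i]
    · simp
    · intro j _ hj
      simp [Pi.single_eq_of_ne hj]
    · simp
  rw [neg_add, latticeChar_add_left, h1]
  ring

lemma one_le_norm_latticeChar_single_sub_one {n : Fin d → ℤ} {l : Fin d} {R : ℝ} (hR : 0 < R)
    (h1 : R ≤ |(n l : ℝ)|) (h2 : |(n l : ℝ)| ≤ 2 * R) :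
    1 ≤ ‖latticeChar n (Pi.single l (1 / (4 * R))) - 1‖ := by
  have h3 : ∑ j, (n j : ℝ) * (Pi.single l (1 / (4 * R)) : Fin d → ℝ) j = n l * (1 / (4 * R)) := by
    rw [Finset.sum_eq_single l]
    · rw [Pi.single_eq_same]
    · intro j _ hj
      rw [Pi.single_eq_of_ne hj, mul_zero]
    · simp
  rw [latticeChar_eq_exp_ofReal_mul_I, h3]
  set θ : ℝ := 2 * π * (n l * (1 / (4 * R))) with hθ
  have hre : (Complex.exp (θ * Complex.I) - 1).re = Real.cos θ - 1 := by
    rw [Complex.sub_re, Complex.exp_ofReal_mul_I_re, Complex.one_re]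
  have habs : |θ| = π / 2 * (|(n l : ℝ)| / R) := by
    rw [hθ, abs_mul, abs_mul (n l : ℝ), abs_of_pos Real.two_pi_pos,
      abs_of_pos (show 0 < 1 / (4 * R) by positivity)]
    field_simp
    ring
  have h4 : 1 ≤ |(n l : ℝ)| / R := (one_le_div hR).2 h1
  have h5 : |(n l : ℝ)| / R ≤ 2 := (div_le_iff₀ hR).2 h2
  have hcos : Real.cos θ ≤ 0 := by
    rw [← Real.cos_abs]
    refine Real.cos_nonpos_of_pi_div_two_le_of_le ?_ ?_ <;> rw [habs] <;> nlinarith [Real.pi_pos]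
  have := Complex.abs_re_le_norm (Complex.exp (θ * Complex.I) - 1)
  rw [hre, abs_of_nonpos (by linarith)] at this
  linarith

lemma enorm_le_mul_sq_add {lam : ℝ} (hlam : 0 < lam) (z : ℂ) :
    ‖z‖ₑ ≤ ENNReal.ofReal lam * ‖z‖ₑ ^ 2 + ENNReal.ofReal lam⁻¹ := by
  rw [← ofReal_norm, ← ENNReal.ofReal_pow (norm_nonneg _), ← ENNReal.ofReal_mul hlam.le,
    ← ENNReal.ofReal_add (by positivity) (by positivity)]
  refine ENNReal.ofReal_le_ofReal ?_
  have h1 : lam * lam⁻¹ = 1 := mul_inv_cancel₀ hlam.ne'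
  have h2 : 0 < lam⁻¹ := inv_pos.2 hlam
  rcases le_total ‖z‖ lam⁻¹ with h | h
  · have : 0 ≤ lam * ‖z‖ ^ 2 := by positivity
    linarith
  · have : lam * lam⁻¹ * ‖z‖ ≤ lam * ‖z‖ * ‖z‖ := by
      gcongr
    nlinarith

end DyadicBlocks

section DyadicSums

variable {d : ℕ}

lemma tsum_slab_enorm_latticeCoeff_sq_le {g : (Fin d → ℝ) → ℂ} (hper : LatticePeriodic g)
    (hmeas : Measurable g) {M : ℝ} (hM : ∀ ξ, ‖g ξ‖ ≤ M) {C : ℝ}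
    (hC : ∀ v, 0 < ‖v‖ → ∀ ξ,
      ‖(fwdDiff v)^[d + 1] g ξ‖ ≤ C * ‖v‖ * (‖v‖ / (‖v‖ + latticeDist ξ)) ^ d)
    {R : ℝ} (hR : 0 < R) (l : Fin d) :
    ∑' n, {n : Fin d → ℤ | R ≤ |(n l : ℝ)| ∧ |(n l : ℝ)| ≤ 2 * R}.indicator
        (fun n => ‖latticeCoeff g n‖ₑ ^ 2) n
      ≤ ENNReal.ofReal (C ^ 2 * (R⁻¹) ^ (d + 2)) := by
  have hh : (0 : ℝ) < 1 / (4 * R) := by positivity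
  set v : Fin d → ℝ := Pi.single l (1 / (4 * R)) with hv
  have hvn : ‖v‖ = 1 / (4 * R) := by
    rw [hv, Pi.norm_single, Real.norm_of_nonneg hh.le]
  have hdiff := fun n => latticeCoeff_fwdDiff_iter hper hmeas hM v n (d + 1)
  obtain ⟨hper', hmeas', hM', -⟩ := hdiff 0
  calc _ ≤ ∑' n, ‖latticeCoeff ((fwdDiff v)^[d + 1] g) n‖ₑ ^ 2 := by
        refine ENNReal.tsum_le_tsum fun n => Set.indicator_apply_le' (fun hn => ?_)
          (fun _ => zero_le)
        have h1 := one_le_norm_latticeChar_single_sub_one hR hn.1 hn.2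
        rw [(hdiff n).2.2.2]
        gcongr
        rw [← ofReal_norm, ← ofReal_norm, norm_mul, norm_pow]
        exact ENNReal.ofReal_le_ofReal
          (le_mul_of_one_le_left (norm_nonneg _) (one_le_pow₀ h1))
    _ = ∫⁻ ξ in unitCube d, ‖(fwdDiff v)^[d + 1] g ξ‖ₑ ^ 2 :=
        tsum_enorm_latticeCoeff_sq hper' hmeas' hM'
    _ ≤ ENNReal.ofReal ((C * (1 / (4 * R))) ^ 2 * (2 * (1 / (4 * R))) ^ d) := by
        refine lintegral_unitCube_enorm_sq_le hh fun ξ => ?_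
        have := hC v (hvn ▸ hh) ξ
        rwa [hvn] at this
    _ ≤ _ := by
        refine ENNReal.ofReal_le_ofReal ?_
        have hR' : 0 < R⁻¹ := inv_pos.2 hR
        have e1 : 1 / (4 * R) = R⁻¹ / 4 := by field_simp
        rw [e1, mul_pow, mul_assoc, pow_add, mul_comm (R⁻¹ ^ d)]
        gcongr <;> linarith

lemma tsum_annulus_enorm_latticeCoeff_le (hd : d ≠ 0) {g : (Fin d → ℝ) → ℂ}
    (hper : LatticePeriodic g) (hmeas : Measurable g) {M : ℝ} (hM : ∀ ξ, ‖g ξ‖ ≤ M) {C : ℝ}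
    (hC : ∀ v, 0 < ‖v‖ → ∀ ξ,
      ‖(fwdDiff v)^[d + 1] g ξ‖ ≤ C * ‖v‖ * (‖v‖ / (‖v‖ + latticeDist ξ)) ^ d) (j : ℕ) :
    ∑' n, {n : Fin d → ℤ | 2 ^ j ≤ ‖n‖ ∧ ‖n‖ < 2 * 2 ^ j}.indicator
        (fun n => ‖latticeCoeff g n‖ₑ) n
      ≤ ENNReal.ofReal ((d * C ^ 2 + 8 ^ d) * (2 ^ j)⁻¹) := by
  set R : ℝ := 2 ^ j with hRdef
  have hR : 0 < R := by positivity
  have : Nonempty (Fin d) := Fin.pos_iff_nonempty.1 (Nat.pos_of_ne_zero hd)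
  set S : Set (Fin d → ℤ) := {n | R ≤ ‖n‖ ∧ ‖n‖ < 2 * R} with hS
  have hsq : ∑' n, S.indicator (fun n => ‖latticeCoeff g n‖ₑ ^ 2) n
      ≤ d * ENNReal.ofReal (C ^ 2 * (R⁻¹) ^ (d + 2)) := by
    calc _ ≤ ∑' n, ∑ l : Fin d, {n : Fin d → ℤ | R ≤ |(n l : ℝ)| ∧ |(n l : ℝ)| ≤ 2 * R}.indicator
            (fun n => ‖latticeCoeff g n‖ₑ ^ 2) n := by
          refine ENNReal.tsum_le_tsum fun n => Set.indicator_apply_le' (fun hn => ?_)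
            (fun _ => zero_le)
          obtain ⟨l, hl⟩ := Finite.exists_max fun i => ‖n i‖
          replace hl : ‖n l‖ = ‖n‖ := le_antisymm (norm_le_pi_norm n l)
            ((pi_norm_le_iff_of_nonneg (norm_nonneg _)).2 hl)
          refine le_trans (le_of_eq ?_) (Finset.single_le_sum (fun _ _ => zero_le)
            (Finset.mem_univ l))
          rw [Set.indicator_of_mem]
          rw [Int.norm_eq_abs] at hl
          refine ⟨?_, ?_⟩
          · rw [hl]; exact hn.1
          · rw [hl]; exact hn.2.le
      _ = ∑ l : Fin d, ∑' n, {n : Fin d → ℤ | R ≤ |(n l : ℝ)| ∧ |(n l : ℝ)| ≤ 2 * R}.indicator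
            (fun n => ‖latticeCoeff g n‖ₑ ^ 2) n :=
          Summable.tsum_finsetSum fun _ _ => ENNReal.summable
      _ ≤ ∑ _l : Fin d, ENNReal.ofReal (C ^ 2 * (R⁻¹) ^ (d + 2)) :=
          Finset.sum_le_sum fun l _ => tsum_slab_enorm_latticeCoeff_sq_le hper hmeas hM hC hR l
      _ = _ := by simp
  have hcount : ∑' n, S.indicator (1 : (Fin d → ℤ) → ℝ≥0∞) n ≤ ENNReal.ofReal (8 ^ d * R ^ d) := by
    rw [← count_eq_tsum]
    refine (measure_mono fun n hn => ?_).trans ((count_norm_sub_lt_le j 0).trans (le_of_eq ?_))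
    · change ‖n - 0‖ < 4 * R
      rw [sub_zero]
      linarith [hn.2]
    · rw [ENNReal.ofReal_mul (by positivity), ENNReal.ofReal_pow (by positivity),
        ENNReal.ofReal_pow hR.le, hRdef, ENNReal.ofReal_pow (by positivity)]
      simp
  have hlam : 0 < R ^ (d + 1) := by positivity
  calc _ ≤ ∑' n, (ENNReal.ofReal (R ^ (d + 1)) * S.indicator (fun n => ‖latticeCoeff g n‖ₑ ^ 2) n
          + ENNReal.ofReal (R ^ (d + 1))⁻¹ * S.indicator (1 : (Fin d → ℤ) → ℝ≥0∞) n) := by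
        refine ENNReal.tsum_le_tsum fun n => ?_
        by_cases hn : n ∈ S
        · simpa only [Set.indicator_of_mem hn, Pi.one_apply, mul_one] using
            enorm_le_mul_sq_add hlam _
        · simp only [Set.indicator_of_notMem hn, zero_le]
    _ ≤ ENNReal.ofReal (R ^ (d + 1)) * (d * ENNReal.ofReal (C ^ 2 * (R⁻¹) ^ (d + 2)))
          + ENNReal.ofReal (R ^ (d + 1))⁻¹ * ENNReal.ofReal (8 ^ d * R ^ d) := by
        rw [ENNReal.tsum_add, ENNReal.tsum_mul_left, ENNReal.tsum_mul_left]
        gcongr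
    _ = _ := by
        rw [← ENNReal.ofReal_natCast, ← ENNReal.ofReal_mul (by positivity),
          ← ENNReal.ofReal_mul (by positivity), ← ENNReal.ofReal_mul (by positivity),
          ← ENNReal.ofReal_add (by positivity) (by positivity)]
        congr 1
        rw [inv_pow]
        field_simp
        ring

lemma tsum_tail_enorm_latticeCoeff_le (hd : d ≠ 0) {g : (Fin d → ℝ) → ℂ}
    (hper : LatticePeriodic g) (hmeas : Measurable g) {M : ℝ} (hM : ∀ ξ, ‖g ξ‖ ≤ M) {C : ℝ}
    (hC : ∀ v, 0 < ‖v‖ → ∀ ξ,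
      ‖(fwdDiff v)^[d + 1] g ξ‖ ≤ C * ‖v‖ * (‖v‖ / (‖v‖ + latticeDist ξ)) ^ d) (j : ℕ) :
    ∑' n, {n : Fin d → ℤ | 2 ^ j ≤ ‖n‖}.indicator (fun n => ‖latticeCoeff g n‖ₑ) n
      ≤ ENNReal.ofReal (2 * (d * C ^ 2 + 8 ^ d) * (2 ^ j)⁻¹) := by
  set D : ℝ := d * C ^ 2 + 8 ^ d with hD
  calc _ ≤ ∑' n, ∑' k : ℕ, {n : Fin d → ℤ | 2 ^ (j + k) ≤ ‖n‖ ∧ ‖n‖ < 2 * 2 ^ (j + k)}.indicator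
          (fun n => ‖latticeCoeff g n‖ₑ) n := by
        refine ENNReal.tsum_le_tsum fun n => Set.indicator_apply_le' (fun hn => ?_)
          (fun _ => zero_le)
        have hj : (0 : ℝ) < 2 ^ j := by positivity
        obtain ⟨k, hk1, hk2⟩ := exists_nat_pow_near ((one_le_div hj).2 hn) (one_lt_two (α := ℝ))
        rw [le_div_iff₀ hj] at hk1
        rw [div_lt_iff₀ hj, pow_succ] at hk2
        refine le_trans (le_of_eq ?_) (ENNReal.le_tsum k)
        rw [Set.indicator_of_mem]
        refine ⟨?_, ?_⟩ <;> rw [pow_add] <;> linarith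
    _ = ∑' k : ℕ, ∑' n, {n : Fin d → ℤ | 2 ^ (j + k) ≤ ‖n‖ ∧ ‖n‖ < 2 * 2 ^ (j + k)}.indicator
          (fun n => ‖latticeCoeff g n‖ₑ) n := ENNReal.tsum_comm
    _ ≤ ∑' k : ℕ, ENNReal.ofReal (D * (2 ^ (j + k))⁻¹) :=
        ENNReal.tsum_le_tsum fun k => tsum_annulus_enorm_latticeCoeff_le hd hper hmeas hM hC _
    _ = ENNReal.ofReal (2 * D * (2 ^ j)⁻¹) := by
        have hsum : HasSum (fun k : ℕ => D * (2 ^ (j + k))⁻¹) (2 * D * (2 ^ j)⁻¹) := by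
          have h := hasSum_geometric_two.mul_left (D * (2 ^ j)⁻¹)
          rw [show D * (2 ^ j)⁻¹ * 2 = 2 * D * (2 ^ j)⁻¹ by ring] at h
          refine h.congr_fun fun k => ?_
          rw [pow_add, mul_inv, one_div, inv_pow, mul_assoc]
        rw [← hsum.tsum_eq, ENNReal.ofReal_tsum_of_nonneg (fun k => by positivity) hsum.summable]

end DyadicSums

section Assembly

variable {d : ℕ}

/-- The convolution kernel of a Mikhlin multiplier satisfies the Hörmander condition. -/
lemma exists_tailIncrement_latticeCoeff_le (hd : d ≠ 0) {m : (Fin d → ℝ) → ℂ}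
    (hper : LatticePeriodic m) {M : ℝ} (hM : ∀ ξ, ‖m ξ‖ ≤ M) {c : ℝ}
    (hsmooth : ContDiffOn ℝ (d + 1 : ℕ) m (latticeComp d))
    (hm : ∀ k ≤ d + 1, ∀ ξ ∈ latticeComp d, latticeDist ξ ^ k * ‖iteratedFDeriv ℝ k m ξ‖ ≤ c) :
    ∃ H : ℝ, ∀ (j : ℕ) (z : Fin d → ℤ), ‖z‖ ≤ 2 ^ j →
      tailIncrement (latticeCoeff m) (4 * 2 ^ j) z ≤ ENNReal.ofReal H := by
  have hmeas := measurable_of_continuousOn_latticeComp hsmooth.continuousOn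
  have hM0 : 0 ≤ M := (norm_nonneg _).trans (hM 0)
  have hcoord : ∀ i : Fin d, ∃ D : ℝ, ∀ j : ℕ,
      tailIncrement (latticeCoeff m) (2 ^ j) (Pi.single i 1) ≤ ENNReal.ofReal (D * (2 ^ j)⁻¹) := by
    intro i
    have hgsmooth : ContDiffOn ℝ (d + 1 : ℕ) (fun ξ => m ξ * shiftSymbol i ξ) (latticeComp d) :=
      hsmooth.mul (contDiff_shiftSymbol i).contDiffOn
    have hgper : LatticePeriodic fun ξ => m ξ * shiftSymbol i ξ := fun ξ n => by
      simp only [hper ξ n, shiftSymbol_periodic i ξ n]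
    have hgA : ∀ ξ, ‖m ξ * shiftSymbol i ξ‖ ≤ M * (2 * π) * latticeDist ξ := fun ξ => by
      rw [norm_mul, mul_assoc]
      exact mul_le_mul (hM ξ) (norm_shiftSymbol_le i ξ) (norm_nonneg _) hM0
    have hgM : ∀ ξ, ‖m ξ * shiftSymbol i ξ‖ ≤ M * 2 := fun ξ => by
      rw [norm_mul]
      refine mul_le_mul (hM ξ) ?_ (norm_nonneg _) hM0
      refine (norm_sub_le _ _).trans (le_of_eq ?_)
      rw [norm_one, show -(2 * (π : ℂ) * Complex.I) * ξ i = ((-(2 * π * ξ i) : ℝ) : ℂ) * Complex.I by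
        push_cast; ring, Complex.norm_exp_ofReal_mul_I]
      norm_num
    obtain ⟨B, hB⟩ :=
      exists_latticeDist_pow_mul_norm_iteratedFDeriv_mul_shiftSymbol_le hsmooth hm i
    obtain ⟨C, -, hC⟩ := exists_norm_fwdDiff_iter_le hgsmooth hgA hB
    refine ⟨2 * (d * C ^ 2 + 8 ^ d), fun j => ?_⟩
    refine le_trans (le_of_eq ?_) (tsum_tail_enorm_latticeCoeff_le hd hgper
      (measurable_of_continuousOn_latticeComp hgsmooth.continuousOn) hgM hC j)
    simp only [tailIncrement, latticeCoeff_mul_shiftSymbol hmeas hM]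
  choose D hD using hcoord
  refine ⟨d * ∑ i, |D i|, fun j z hz => ?_⟩
  refine (tailIncrement_le (latticeCoeff m) (B := ENNReal.ofReal ((∑ i, |D i|) * (2 ^ j)⁻¹))
    (fun i => (hD i j).trans ?_) hz).trans (le_of_eq ?_)
  · refine ENNReal.ofReal_le_ofReal ?_
    gcongr
    exact (le_abs_self _).trans
      (Finset.single_le_sum (f := fun i => |D i|) (fun _ _ => abs_nonneg _) (Finset.mem_univ i))
  · have h0 : 0 ≤ ∑ i, |D i| := Finset.sum_nonneg fun _ _ => abs_nonneg _
    rw [← ENNReal.ofReal_natCast, show (2 : ℝ≥0∞) ^ j = ENNReal.ofReal (2 ^ j) by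
      rw [ENNReal.ofReal_pow zero_le_two, ENNReal.ofReal_ofNat],
      ← ENNReal.ofReal_mul (by positivity), ← ENNReal.ofReal_mul (by positivity)]
    congr 1
    field_simp

lemma latticeConv_add {K : (Fin d → ℤ) → ℂ} {B : ℝ} (hB : ∀ n, ‖K n‖ ≤ B)
    {f g : (Fin d → ℤ) → ℂ} (hf : Summable fun n => ‖f n‖) (hg : Summable fun n => ‖g n‖) :
    latticeConv K (fun n => f n + g n) = fun n => latticeConv K f n + latticeConv K g n := by
  funext n
  simp only [latticeConv, add_mul]
  exact (summable_mul_of_bounded hf fun k => hB (n - k)).tsum_add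
    (summable_mul_of_bounded hg fun k => hB (n - k))

lemma tailIncrement_comp_neg (K : (Fin d → ℤ) → ℂ) (ρ : ℝ) (z : Fin d → ℤ) :
    tailIncrement (fun n => K (-n)) ρ z = tailIncrement K ρ (-z) := by
  rw [tailIncrement, tailIncrement, ← (Equiv.neg (Fin d → ℤ)).tsum_eq
    ({n : Fin d → ℤ | ρ ≤ ‖n‖}.indicator fun n => ‖K (n + -z) - K n‖ₑ)]
  refine tsum_congr fun n => ?_
  simp only [Set.indicator_apply, Set.mem_ofPred_eq, Equiv.neg_apply, norm_neg, neg_add]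

lemma latticeConv_comp_neg (K f : (Fin d → ℤ) → ℂ) (n : Fin d → ℤ) :
    latticeConv (fun n => K (-n)) f n = latticeConv K (fun k => f (-k)) (-n) := by
  rw [latticeConv, latticeConv, ← (Equiv.neg (Fin d → ℤ)).tsum_eq]
  refine tsum_congr fun k => ?_
  simp only [Equiv.neg_apply]
  congr 2
  abel

/-- A convolution operator bounded on `ℓ²` whose kernel satisfies the Hörmander condition is
bounded on `ℓ^p` for `1 < p < 2`. -/
lemma exists_latticeConv_strongType (hd : d ≠ 0) {K : (Fin d → ℤ) → ℂ} {B : ℝ}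
    (hB : ∀ n, ‖K n‖ ≤ B) {A H : ℝ}
    (hL2 : ∀ f : (Fin d → ℤ) → ℂ, Summable (fun n => ‖f n‖) →
      ∑' n, ‖latticeConv K f n‖ₑ ^ 2 ≤ ENNReal.ofReal A * ∑' n, ‖f n‖ₑ ^ 2)
    (hH : ∀ (j : ℕ) (z : Fin d → ℤ), ‖z‖ ≤ 2 ^ j →
      tailIncrement K (4 * 2 ^ j) z ≤ ENNReal.ofReal H)
    {p : ℝ} (hp : 1 < p) (hp2 : p < 2) :
    ∃ C : ℝ≥0∞, C ≠ ∞ ∧ ∀ f : (Fin d → ℤ) → ℂ, Summable (fun n => ‖f n‖) →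
      ∑' n, ‖latticeConv K f n‖ₑ ^ p ≤ C * ∑' n, ‖f n‖ₑ ^ p := by
  refine ⟨_, ?_, fun f hf => strongType_of_weakType (fun f g hf hg => latticeConv_add hB hf hg) hL2
    (fun f hf t ht ht' => latticeConv_weakType hd hB hL2 (H := ENNReal.ofReal H)
      (fun j y hy => ?_) hf ht ht') hp hp2 hf⟩
  · finiteness
  · have := hH j (-y) (by rw [norm_neg]; exact hy.le)
    simpa only [tailIncrement, ← sub_eq_add_neg] using this

lemma lpNorm_eq_tsum {p : ℝ} (hp : 0 < p) (f : (Fin d → ℤ) → ℂ) :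
    lpNorm d f p = (∑' n, ‖f n‖ₑ ^ p) ^ (1 / p) := by
  rw [_root_.lpNorm, eLpNorm_eq_lintegral_rpow_enorm_toReal (by simpa using hp) ENNReal.ofReal_ne_top,
    lintegral_count, ENNReal.toReal_ofReal hp.le]

lemma exists_lpNorm_le_of_tsum_le {p : ℝ} (hp : 0 < p)
    {T : ((Fin d → ℤ) → ℂ) → (Fin d → ℤ) → ℂ}
    (hT : ∃ C : ℝ≥0∞, C ≠ ∞ ∧ ∀ f : (Fin d → ℤ) → ℂ, Summable (fun n => ‖f n‖) →
      ∑' n, ‖T f n‖ₑ ^ p ≤ C * ∑' n, ‖f n‖ₑ ^ p) :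
    ∃ C : ℝ, 0 < C ∧ ∀ f : (Fin d → ℤ) → ℂ, Summable (fun n => ‖f n‖) →
      lpNorm d (T f) p ≤ ENNReal.ofReal C * lpNorm d f p := by
  obtain ⟨C, hC, h⟩ := hT
  refine ⟨(C ^ (1 / p)).toReal + 1, by positivity, fun f hf => ?_⟩
  have hC' : C ^ (1 / p) ≠ ∞ := ENNReal.rpow_ne_top_of_nonneg (by positivity) hC
  rw [lpNorm_eq_tsum hp, lpNorm_eq_tsum hp]
  calc _ ≤ (C * ∑' n, ‖f n‖ₑ ^ p) ^ (1 / p) := ENNReal.rpow_le_rpow (h f hf) (by positivity)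
    _ = C ^ (1 / p) * (∑' n, ‖f n‖ₑ ^ p) ^ (1 / p) := ENNReal.mul_rpow_of_nonneg _ _ (by positivity)
    _ ≤ _ := by
      gcongr
      refine (ENNReal.ofReal_toReal hC').symm.le.trans (ENNReal.ofReal_le_ofReal ?_)
      linarith

end Assembly

/-- Mikhlin–Hörmander multiplier theorem on `ℤ^d`: if `m` is bounded on the torus, of
class `C^{d+1}` on `ℝ^d \ ℤ^d`, and satisfies `|∂^α m(ξ)| ≤ c|ξ|^{−|α|}` on
`(−1/2,1/2)^d \ {0}` for all `|α| ≤ d+1`, then `T_m` extends to a bounded operator on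
`ℓ^p(ℤ^d)` for all `1 < p < ∞`. -/
theorem stmt_10 (d : ℕ) (m : (Fin d → ℝ) → ℂ)
    (hper : ∀ (ξ : Fin d → ℝ) (n : Fin d → ℤ), m (ξ + fun i => (n i : ℝ)) = m ξ)
    (M : ℝ) (hbdd : ∀ ξ, ‖m ξ‖ ≤ M)
    (hsmooth : ContDiffOn ℝ (d + 1 : ℕ) m (latticeComp d))
    (c : ℝ) (hc : 0 < c)
    (hmik : ∀ k : ℕ, k ≤ d + 1 →
      ∀ ξ ∈ Set.univ.pi fun _ : Fin d => Set.Ioo (-(1/2) : ℝ) (1/2), ξ ≠ 0 →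
        ‖iteratedFDerivWithin ℝ k m (latticeComp d) ξ‖ ≤ c * euclNorm d ξ ^ (-(k : ℝ))) :
    ∀ p : ℝ, 1 < p →
      ∃ C : ℝ, 0 < C ∧ ∀ f : (Fin d → ℤ) → ℂ, Summable (fun n => ‖f n‖) →
        lpNorm d (Tmult d m f) p ≤ ENNReal.ofReal C * lpNorm d f p := by
  intro p hp
  have hp0 : 0 < p := one_pos.trans hp
  have hmeas := measurable_of_continuousOn_latticeComp hsmooth.continuousOn
  refine exists_lpNorm_le_of_tsum_le hp0 ?_
  have hL2 : ∀ f : (Fin d → ℤ) → ℂ, Summable (fun n => ‖f n‖) →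
      ∑' n, ‖latticeConv (latticeCoeff m) f n‖ₑ ^ 2
        ≤ ENNReal.ofReal (M ^ 2) * ∑' n, ‖f n‖ₑ ^ 2 := fun f hf => by
    rw [← Tmult_eq_latticeConv hmeas hbdd hf]
    exact tsum_enorm_Tmult_sq_le hper hmeas hbdd hf
  have hK := norm_latticeCoeff_le hbdd
  suffices h : ∃ C : ℝ≥0∞, C ≠ ∞ ∧ ∀ f : (Fin d → ℤ) → ℂ, Summable (fun n => ‖f n‖) →
      ∑' n, ‖latticeConv (latticeCoeff m) f n‖ₑ ^ p ≤ C * ∑' n, ‖f n‖ₑ ^ p by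
    obtain ⟨C, hC, h⟩ := h
    refine ⟨C, hC, fun f hf => ?_⟩
    rw [Tmult_eq_latticeConv hmeas hbdd hf]
    exact h f hf
  rcases eq_or_ne d 0 with rfl | hd
  · refine ⟨ENNReal.ofReal M ^ p, by finiteness, fun f _ => ?_⟩
    simp only [tsum_fintype, Finset.univ_unique, Finset.sum_singleton, latticeConv]
    rw [← ENNReal.mul_rpow_of_nonneg _ _ hp0.le, enorm_mul, mul_comm]
    gcongr
    rw [← ofReal_norm]
    exact ENNReal.ofReal_le_ofReal (hK _)
  obtain ⟨H, hH⟩ := exists_tailIncrement_latticeCoeff_le hd hper hbdd hsmooth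
    fun k hk ξ hξ => latticeDist_pow_mul_norm_iteratedFDeriv_le hper hsmooth hk (hmik k hk) hξ
  rcases lt_trichotomy p 2 with hp2 | rfl | hp2
  · exact exists_latticeConv_strongType hd hK hL2 hH hp hp2
  · exact ⟨ENNReal.ofReal (M ^ 2), ENNReal.ofReal_ne_top, fun f hf => by
      simpa only [ENNReal.rpow_ofNat] using hL2 f hf⟩
  · have hpq := Real.HolderConjugate.conjExponent hp
    set q := p.conjExponent with hq
    have hq2 : q < 2 := by
      rw [hq, Real.conjExponent, div_lt_iff₀ (by linarith)]
      linarith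
    have hL2' : ∀ f : (Fin d → ℤ) → ℂ, Summable (fun n => ‖f n‖) →
        ∑' n, ‖latticeConv (fun n => latticeCoeff m (-n)) f n‖ₑ ^ 2
          ≤ ENNReal.ofReal (M ^ 2) * ∑' n, ‖f n‖ₑ ^ 2 := fun f hf => by
      have h := hL2 (fun k => f (-k)) ((Equiv.neg (Fin d → ℤ)).summable_iff.2 hf)
      rw [← (Equiv.neg (Fin d → ℤ)).tsum_eq (fun n => ‖f n‖ₑ ^ 2),
        ← (Equiv.neg (Fin d → ℤ)).tsum_eq]
      simpa only [latticeConv_comp_neg, Equiv.neg_apply, neg_neg] using h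
    obtain ⟨C, hC, h⟩ := exists_latticeConv_strongType hd (fun n => hK (-n)) hL2'
      (fun j z hz => (tailIncrement_comp_neg _ _ _).trans_le (hH j (-z) (by rwa [norm_neg])))
      hpq.symm.lt hq2
    have hq0 := hpq.symm.pos
    exact ⟨(C ^ (1 / q)) ^ p, by finiteness, fun f hf => latticeConv_strongType_dual hK hpq h hf⟩
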